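/- Let D be a connected C-homogeneous triangle-free digraph with more than one end. Then for every edge e of D the reachability digraph Δ_e is bipartite, i.e. the underlying undirected graph of Δ_e contains no cycle of odd length. -/

import Mathlib

open Set

universe u

/-- The underlying undirected graph of a digraph given by its edge relation. -/
def UG {V : Type u} (E : V → V → Prop) : SimpleGraph V := SimpleGraph.fromRel E

/-- `E` is a digraph edge relation: irreflexive and antisymmetric. -/
def IsDigraph {V : Type u} (E : V → V → Prop) : Prop :=
  (∀ x, ¬ E x x) ∧ ∀ x y, E x y → ¬ E y x

/-- A ray in a graph: a one-way infinite path. -/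
def IsRay {V : Type u} (G : SimpleGraph V) (r : ℕ → V) : Prop :=
  Function.Injective r ∧ ∀ n, G.Adj (r n) (r (n + 1))

/-- A sequence is eventually in a set. -/
def EventuallyIn {V : Type u} (r : ℕ → V) (C : Set V) : Prop :=
  ∃ N, ∀ n, N ≤ n → r n ∈ C

/-- `C` is a connected component of the subgraph of `G` induced on `W`:
a maximal connected subset of `W`. -/
def IsCompOf {V : Type u} (G : SimpleGraph V) (C W : Set V) : Prop :=
  C.Nonempty ∧ C ⊆ W ∧ (G.induce C).Connected ∧
    ∀ C', C ⊆ C' → C' ⊆ W → (G.induce C').Connected → C' = C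

/-- Two rays are equivalent if for every finite vertex set `S` they lie eventually
in the same component of the graph minus `S`. -/
def RayEquiv {V : Type u} (G : SimpleGraph V) (r r' : ℕ → V) : Prop :=
  ∀ S : Finset V, ∃ C : Set V, IsCompOf G C {v | v ∉ S} ∧
    EventuallyIn r C ∧ EventuallyIn r' C

/-- The graph has more than one end: two inequivalent rays. -/
def MoreThanOneEnd {V : Type u} (G : SimpleGraph V) : Prop :=
  ∃ r r' : ℕ → V, IsRay G r ∧ IsRay G r' ∧ ¬ RayEquiv G r r'

/-- The graph has infinitely many ends: arbitrarily large families of pairwise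
inequivalent rays. -/
def InfinitelyManyEnds {V : Type u} (G : SimpleGraph V) : Prop :=
  ∀ n : ℕ, ∃ f : Fin n → (ℕ → V), (∀ i, IsRay G (f i)) ∧
    ∀ i j, i ≠ j → ¬ RayEquiv G (f i) (f j)

/-- A separation of a graph: a pair of vertex sets covering `V` such that every
edge lies within one side. -/
def IsSeparation {V : Type u} (G : SimpleGraph V) (c : Set V × Set V) : Prop :=
  c.1 ∪ c.2 = univ ∧ ∀ x y, G.Adj x y → (x ∈ c.1 ∧ y ∈ c.1) ∨ (x ∈ c.2 ∧ y ∈ c.2)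

/-- The order of a separation: the number of vertices in its separator. -/
noncomputable def sepOrder {V : Type u} (c : Set V × Set V) : ℕ := (c.1 ∩ c.2).ncard

/-- The neighbourhood of a vertex set. -/
def Nbhd {V : Type u} (G : SimpleGraph V) (A : Set V) : Set V :=
  {v | v ∉ A ∧ ∃ u ∈ A, G.Adj u v}

/-- The separation `(A, ∼)`. -/
def tildeSep {V : Type u} (G : SimpleGraph V) (A : Set V) : Set V × Set V :=
  (A, Aᶜ ∪ Nbhd G Aᶜ)

/-- `S` separates the wings of the separation `c`: every walk from one wing to
the other meets `S`. -/
def SeparatesWings {V : Type u} (G : SimpleGraph V) (c : Set V × Set V) (S : Set V) : Prop :=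
  ∀ a ∈ c.1 \ c.2, ∀ b ∈ c.2 \ c.1, ∀ w : G.Walk a b, ∃ v ∈ w.support, v ∈ S

/-- A separation of finite order with non-empty wings is essential if its first wing is
connected and no proper subset of the separator separates the wings. -/
def IsEssential {V : Type u} (G : SimpleGraph V) (c : Set V × Set V) : Prop :=
  IsSeparation G c ∧ (c.1 ∩ c.2).Finite ∧ (c.1 \ c.2).Nonempty ∧ (c.2 \ c.1).Nonempty ∧
  (G.induce (c.1 \ c.2)).Connected ∧
  ∀ S, S ⊂ c.1 ∩ c.2 → ¬ SeparatesWings G c S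

/-- `C` is a wing of some separation in `𝒞`. -/
def IsWingOf {V : Type u} (𝒞 : Set (Set V × Set V)) (C : Set V) : Prop :=
  ∃ d ∈ 𝒞, C = d.1 \ d.2 ∨ C = d.2 \ d.1

/-- A cut system. -/
def IsCutSystem {V : Type u} (G : SimpleGraph V) (𝒞 : Set (Set V × Set V)) : Prop :=
  𝒞.Nonempty ∧ (∀ c ∈ 𝒞, IsEssential G c) ∧
  (∀ c ∈ 𝒞, ∃ d ∈ 𝒞, d.1 ⊆ c.2) ∧
  (∀ c ∈ 𝒞, ∀ C : Set V, IsCompOf G C (c.2 \ c.1) →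
    (∃ d ∈ 𝒞, d.1 \ d.2 ⊆ C) → tildeSep G (C ∪ Nbhd G C) ∈ 𝒞) ∧
  (∀ c ∈ 𝒞, ∀ c' ∈ 𝒞, ∃ C₁ C₂ : Set V,
    ((IsCompOf G C₁ ((c.1 \ c.2) ∩ (c'.1 \ c'.2)) ∧
      IsCompOf G C₂ ((c.2 \ c.1) ∩ (c'.2 \ c'.1))) ∨
     (IsCompOf G C₁ ((c.2 \ c.1) ∩ (c'.1 \ c'.2)) ∧
      IsCompOf G C₂ ((c.1 \ c.2) ∩ (c'.2 \ c'.1)))) ∧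
    IsWingOf 𝒞 C₁ ∧ IsWingOf 𝒞 C₂)

/-- Pick a side of a separation. -/
def pickSide {V : Type u} (c : Set V × Set V) : Bool → Set V
  | false => c.1
  | true => c.2

/-- Two cuts are nested (with respect to the cut system `𝒞`). -/
def NestedPair {V : Type u} (G : SimpleGraph V) (𝒞 : Set (Set V × Set V))
    (c d : Set V × Set V) : Prop :=
  ∃ i j : Bool,
    ((¬ ∃ C, IsCompOf G C ((tildeSep G (pickSide c i ∩ pickSide d j)).1 \
        (tildeSep G (pickSide c i ∩ pickSide d j)).2) ∧
        tildeSep G (C ∪ Nbhd G C) ∈ 𝒞) ∨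
     (¬ ∃ C, IsCompOf G C ((tildeSep G (pickSide c i ∩ pickSide d j)).2 \
        (tildeSep G (pickSide c i ∩ pickSide d j)).1) ∧
        tildeSep G (C ∪ Nbhd G C) ∈ 𝒞)) ∧
    (c.1 ∩ c.2) ∪ (d.1 ∩ d.2) ⊆ pickSide c (!i) ∩ pickSide d (!j)

/-- A cut system is nested if each two of its cuts are nested. -/
def IsNestedSystem {V : Type u} (G : SimpleGraph V) (𝒞 : Set (Set V × Set V)) : Prop :=
  ∀ c ∈ 𝒞, ∀ d ∈ 𝒞, NestedPair G 𝒞 c d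

/-- `S` is a `𝒞`-separator. -/
def IsSeparatorOf {V : Type u} (𝒞 : Set (Set V × Set V)) (S : Set V) : Prop :=
  ∃ c ∈ 𝒞, c.1 ∩ c.2 = S

/-- A vertex set contains an end: some ray lies in it. -/
def ContainsEnd {V : Type u} (G : SimpleGraph V) (A : Set V) : Prop :=
  ∃ r : ℕ → V, IsRay G r ∧ ∀ n, r n ∈ A

/-- A basic cut system. -/
def IsBasic {V : Type u} (G : SimpleGraph V) (𝒞 : Set (Set V × Set V)) : Prop :=
  IsCutSystem G 𝒞 ∧
  (∀ c ∈ 𝒞, ∀ d ∈ 𝒞, ¬ sepOrder c < sepOrder d) ∧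
  IsNestedSystem G 𝒞 ∧
  (∀ φ : G ≃g G, ∀ c ∈ 𝒞, ((⇑φ '' c.1, ⇑φ '' c.2) : Set V × Set V) ∈ 𝒞) ∧
  (∀ S S' : Set V, IsSeparatorOf 𝒞 S → IsSeparatorOf 𝒞 S' → ∃ φ : G ≃g G, ⇑φ '' S = S') ∧
  (∀ c ∈ 𝒞, ContainsEnd G c.1 ∧ ContainsEnd G c.2 ∧
    ¬ ∃ d : Set V × Set V, IsSeparation G d ∧ (d.1 ∩ d.2).Finite ∧
      (d.1 ∩ d.2).ncard < sepOrder c ∧ ContainsEnd G d.1 ∧ ContainsEnd G d.2)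

/-- The defining property of a `𝒞`-block. -/
def BlockProp {V : Type u} (𝒞 : Set (Set V × Set V)) (X : Set V) : Prop :=
  (∀ c ∈ 𝒞, (X ⊆ c.1 ∨ X ⊆ c.2) ∧ ¬ (X ⊆ c.1 ∧ X ⊆ c.2)) ∧
  ∃ c ∈ 𝒞, X ⊆ c.1 ∧ c.1 ∩ c.2 ⊆ X

/-- A `𝒞`-block: a maximal vertex set with the block property. -/
def IsCBlock {V : Type u} (𝒞 : Set (Set V × Set V)) (X : Set V) : Prop :=
  BlockProp 𝒞 X ∧ ∀ X', X ⊆ X' → BlockProp 𝒞 X' → X' = X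

/-- A digraph is C-homogeneous: every isomorphism between finite induced
subdigraphs with connected underlying graphs extends to an automorphism. -/
def DigraphCHom {V : Type u} (E : V → V → Prop) : Prop :=
  ∀ (X Y : Set V), X.Finite → Y.Finite → ((UG E).induce X).Connected →
  ∀ φ : X ≃ Y, (∀ a b : X, E a.1 b.1 ↔ E (φ a).1 (φ b).1) →
  ∃ ψ : Equiv.Perm V, (∀ x y, E (ψ x) (ψ y) ↔ E x y) ∧ ∀ a : X, ψ a.1 = (φ a).1

/-- A graph is C-homogeneous: every isomorphism between finite connected induced
subgraphs extends to an automorphism. -/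
def GraphCHom {V : Type u} (G : SimpleGraph V) : Prop :=
  ∀ (X Y : Set V), X.Finite → Y.Finite → (G.induce X).Connected →
  ∀ φ : X ≃ Y, (∀ a b : X, G.Adj a.1 b.1 ↔ G.Adj (φ a).1 (φ b).1) →
  ∃ ψ : G ≃g G, ∀ a : X, ψ a.1 = (φ a).1

/-- The digraph contains a triangle: three pairwise adjacent vertices. -/
def HasTriangle {V : Type u} (E : V → V → Prop) : Prop :=
  ∃ x y z : V, (UG E).Adj x y ∧ (UG E).Adj y z ∧ (UG E).Adj x z

/-- An `n`-arc: a directed path `p 0, p 1, …, p n`. -/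
def IsArc {V : Type u} (E : V → V → Prop) (n : ℕ) (p : ℕ → V) : Prop :=
  (∀ i j, i ≤ n → j ≤ n → p i = p j → i = j) ∧ ∀ i < n, E (p i) (p (i + 1))

/-- A digraph is highly-arc-transitive: for every `n`, its automorphism group acts
transitively on `n`-arcs. -/
def HighlyArcTransitive {V : Type u} (E : V → V → Prop) : Prop :=
  ∀ n : ℕ, ∀ p q : ℕ → V, IsArc E n p → IsArc E n q →
  ∃ ψ : Equiv.Perm V, (∀ x y, E (ψ x) (ψ y) ↔ E x y) ∧ ∀ i ≤ n, ψ (p i) = q i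

/-- An alternating walk `w 0, …, w n` in a digraph. -/
def IsAltWalk {V : Type u} (E : V → V → Prop) (n : ℕ) (w : ℕ → V) : Prop :=
  (∀ i < n, E (w i) (w (i + 1)) ∨ E (w (i + 1)) (w i)) ∧
  ∀ i, i + 2 ≤ n → (E (w i) (w (i + 1)) ↔ E (w (i + 2)) (w (i + 1)))

/-- The edge `e` lies on the walk `w 0, …, w n` (in either direction). -/
def EdgeOnWalk {V : Type u} (n : ℕ) (w : ℕ → V) (e : V × V) : Prop :=
  ∃ i < n, (w i = e.1 ∧ w (i + 1) = e.2) ∨ (w i = e.2 ∧ w (i + 1) = e.1)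

/-- Two edges are reachable from each other: they lie on a common alternating walk. -/
def Reach {V : Type u} (E : V → V → Prop) (e f : V × V) : Prop :=
  ∃ n w, IsAltWalk E n w ∧ EdgeOnWalk n w e ∧ EdgeOnWalk n w f

/-- The edge relation of the reachability digraph `Δ_e`. -/
def DeltaRel {V : Type u} (E : V → V → Prop) (e : V × V) : V → V → Prop :=
  fun x y => E x y ∧ Reach E e (x, y)

/-- The underlying undirected graph of the reachability digraph `Δ_e`. -/
def DeltaGraph {V : Type u} (E : V → V → Prop) (e : V × V) : SimpleGraph V :=
  UG (DeltaRel E e)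

/-- Tails of edges of `𝒜(e)`. -/
def Tails {V : Type u} (E : V → V → Prop) (e : V × V) : Set V :=
  {x | ∃ y, DeltaRel E e x y}

/-- Heads of edges of `𝒜(e)`. -/
def Heads {V : Type u} (E : V → V → Prop) (e : V × V) : Set V :=
  {y | ∃ x, DeltaRel E e x y}

/-- The set of descendants of a vertex. -/
def Descendants {V : Type u} (E : V → V → Prop) (x : V) : Set V :=
  {y | ∃ n p, IsArc E n p ∧ p 0 = x ∧ p n = y}

/-- `(X, Y)` is a bipartition of the graph `G`. -/
def IsBipartition {V : Type u} (G : SimpleGraph V) (X Y : Set V) : Prop :=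
  X ∪ Y = univ ∧ Disjoint X Y ∧
  ∀ a b, G.Adj a b → (a ∈ X ∧ b ∈ Y) ∨ (a ∈ Y ∧ b ∈ X)

/-- `G` with sides `X`, `Y` is C-homogeneous bipartite: every isomorphism between
finite connected induced subgraphs preserving the sides extends to a side-preserving
automorphism. -/
def BipCHom {V : Type u} (G : SimpleGraph V) (X Y : Set V) : Prop :=
  ∀ (A B : Set V), A.Finite → B.Finite → (G.induce A).Connected →
  ∀ φ : A ≃ B, (∀ a b : A, G.Adj a.1 b.1 ↔ G.Adj (φ a).1 (φ b).1) →
  (∀ a : A, a.1 ∈ X ↔ (φ a).1 ∈ X) → (∀ a : A, a.1 ∈ Y ↔ (φ a).1 ∈ Y) →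
  ∃ ψ : G ≃g G, (∀ v, v ∈ X ↔ ψ v ∈ X) ∧ (∀ v, v ∈ Y ↔ ψ v ∈ Y) ∧
    ∀ a : A, ψ a.1 = (φ a).1

/-- `G` with sides `X`, `Y` is homogeneous bipartite: every isomorphism between
finite induced subgraphs preserving the sides extends to a side-preserving
automorphism. -/
def BipHom {V : Type u} (G : SimpleGraph V) (X Y : Set V) : Prop :=
  ∀ (A B : Set V), A.Finite → B.Finite →
  ∀ φ : A ≃ B, (∀ a b : A, G.Adj a.1 b.1 ↔ G.Adj (φ a).1 (φ b).1) →
  (∀ a : A, a.1 ∈ X ↔ (φ a).1 ∈ X) → (∀ a : A, a.1 ∈ Y ↔ (φ a).1 ∈ Y) →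
  ∃ ψ : G ≃g G, (∀ v, v ∈ X ↔ ψ v ∈ X) ∧ (∀ v, v ∈ Y ↔ ψ v ∈ Y) ∧
    ∀ a : A, ψ a.1 = (φ a).1

/-- `G` with sides `X`, `Y` is generic bipartite. -/
def GenericBip {V : Type u} (G : SimpleGraph V) (X Y : Set V) : Prop :=
  (∀ U W : Set V, U ⊆ X → W ⊆ X → U.Finite → W.Finite → Disjoint U W →
    ∃ v ∈ Y, (∀ u ∈ U, G.Adj v u) ∧ ∀ w ∈ W, ¬ G.Adj v w) ∧
  (∀ U W : Set V, U ⊆ Y → W ⊆ Y → U.Finite → W.Finite → Disjoint U W →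
    ∃ v ∈ X, (∀ u ∈ U, G.Adj v u) ∧ ∀ w ∈ W, ¬ G.Adj v w)

section SeparatedConnectivity

variable {V : Type u} {G : SimpleGraph V}

/-- `u` and `v` lie in the same component of `G` minus `S`. -/
def ConnOff (G : SimpleGraph V) (S : Set V) (u v : V) : Prop :=
  u ∉ S ∧ Relation.ReflTransGen (fun a b => G.Adj a b ∧ b ∉ S) u v

/-- The component of `u` in `G` minus `S` (empty if `u ∈ S`). -/
def compOff (G : SimpleGraph V) (S : Set V) (u : V) : Set V := {v | ConnOff G S u v}

theorem ConnOff.refl {S : Set V} {u : V} (h : u ∉ S) : ConnOff G S u u := ⟨h, .refl⟩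

theorem ConnOff.right_notMem {S : Set V} {u v : V} (h : ConnOff G S u v) : v ∉ S := by
  obtain ⟨hu, h⟩ := h
  induction h with
  | refl => exact hu
  | tail _ h _ => exact h.2

theorem ConnOff.trans {S : Set V} {u v w : V} (h : ConnOff G S u v) (h' : ConnOff G S v w) :
    ConnOff G S u w := ⟨h.1, h.2.trans h'.2⟩

theorem ConnOff.step {S : Set V} {u v w : V} (h : ConnOff G S u v) (hvw : G.Adj v w)
    (hw : w ∉ S) : ConnOff G S u w := ⟨h.1, h.2.tail ⟨hvw, hw⟩⟩

theorem ConnOff.of_adj {S : Set V} {u v : V} (h : G.Adj u v) (hu : u ∉ S) (hv : v ∉ S) :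
    ConnOff G S u v := (ConnOff.refl hu).step h hv

theorem ConnOff.symm {S : Set V} {u v : V} (h : ConnOff G S u v) : ConnOff G S v u := by
  obtain ⟨hu, h⟩ := h
  induction h with
  | refl => exact .refl hu
  | @tail b c hb h ih =>
    have hb' : b ∉ S := ConnOff.right_notMem ⟨hu, hb⟩
    exact (ConnOff.of_adj h.1.symm h.2 hb').trans ih

theorem ConnOff.mem_of_closed {S A : Set V} (hA : ∀ a ∈ A, ∀ b, G.Adj a b → b ∉ S → b ∈ A)
    {u v : V} (hu : u ∈ A) (h : ConnOff G S u v) : v ∈ A := by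
  obtain ⟨-, h⟩ := h
  induction h with
  | refl => exact hu
  | tail _ h ih => exact hA _ ih _ h.1 h.2

theorem ConnOff.mem_of_nbhd {A : Set V} {u v : V} (hu : u ∈ A)
    (h : ConnOff G (Nbhd G A) u v) : v ∈ A := by
  refine h.mem_of_closed (fun a ha b hab hb => ?_) hu
  by_contra hbA
  exact hb ⟨hbA, a, ha, hab⟩

theorem ConnOff.change {S U : Set V} {u v : V} (h : ConnOff G S u v)
    (hU : ∀ k, ConnOff G S u k → k ∉ U) : ConnOff G U u v := by
  obtain ⟨hu, h⟩ := h
  induction h with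
  | refl => exact .refl (hU _ (.refl hu))
  | @tail b c hb h ih => exact ih.step h.1 (hU _ ⟨hu, hb.tail h⟩)

theorem ConnOff.mono {S U : Set V} {u v : V} (h : ConnOff G S u v) (hU : U ⊆ S) :
    ConnOff G U u v := h.change fun _ hk hkU => hk.right_notMem (hU hkU)

theorem ConnOff.image {S : Set V} {u v : V} (ψ : Equiv.Perm V)
    (hψ : ∀ x y, G.Adj (ψ x) (ψ y) ↔ G.Adj x y) (h : ConnOff G S u v) :
    ConnOff G (ψ '' S) (ψ u) (ψ v) := by
  obtain ⟨hu, h⟩ := h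
  induction h with
  | refl => exact .refl (by simpa using hu)
  | tail _ h ih => exact ih.step ((hψ _ _).2 h.1) (by simpa using h.2)

theorem connOff_image_iff {S : Set V} {u v : V} (ψ : Equiv.Perm V)
    (hψ : ∀ x y, G.Adj (ψ x) (ψ y) ↔ G.Adj x y) :
    ConnOff G (ψ '' S) (ψ u) (ψ v) ↔ ConnOff G S u v := by
  refine ⟨fun h => ?_, fun h => h.image ψ hψ⟩
  have := h.image ψ.symm (fun x y => by rw [← hψ]; simp)
  simpa [← Set.image_comp] using this

theorem nbhd_compOff_subset {S : Set V} {u : V} : Nbhd G (compOff G S u) ⊆ S := by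
  rintro v ⟨hv, w, hw, hwv⟩
  by_contra hvS
  exact hv (ConnOff.step hw hwv hvS)

theorem nbhd_image {A : Set V} (ψ : Equiv.Perm V)
    (hψ : ∀ x y, G.Adj (ψ x) (ψ y) ↔ G.Adj x y) : Nbhd G (ψ '' A) = ψ '' Nbhd G A := by
  ext v
  obtain ⟨v, rfl⟩ := ψ.surjective v
  simp only [Nbhd, Set.mem_ofPred_eq, ψ.injective.mem_set_image, Set.exists_mem_image, hψ]

end SeparatedConnectivity

section Tails

variable {V : Type u} {G : SimpleGraph V}

/-- Some ray is eventually in `A`. -/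
def HasTail (G : SimpleGraph V) (A : Set V) : Prop := ∃ r, IsRay G r ∧ EventuallyIn r A

theorem HasTail.mono {A B : Set V} (h : HasTail G A) (hAB : A ⊆ B) : HasTail G B := by
  obtain ⟨r, hr, N, hN⟩ := h
  exact ⟨r, hr, N, fun n hn => hAB (hN n hn)⟩

theorem IsRay.eventually_notMem {r : ℕ → V} (hr : IsRay G r) {S : Set V} (hS : S.Finite) :
    EventuallyIn r Sᶜ := by
  have hf : (r ⁻¹' S).Finite := hS.preimage hr.1.injOn
  obtain ⟨N, hN⟩ := hf.bddAbove
  refine ⟨N + 1, fun n hn hnS => ?_⟩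
  have := hN hnS
  omega

theorem IsRay.connOff {r : ℕ → V} (hr : IsRay G r) {S : Set V} {N : ℕ}
    (hN : ∀ n, N ≤ n → r n ∉ S) (n : ℕ) (hn : N ≤ n) : ConnOff G S (r N) (r n) := by
  induction n, hn using Nat.le_induction with
  | base => exact .refl (hN N le_rfl)
  | succ n hn ih => exact ih.step (hr.2 n) (hN _ (by omega))

theorem HasTail.exists_compOff {A S : Set V} (hA : HasTail G A) (hS : S.Finite) :
    ∃ u ∈ A, u ∉ S ∧ HasTail G (compOff G S u) := by
  obtain ⟨r, hr, N, hN⟩ := hA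
  obtain ⟨M, hM⟩ := hr.eventually_notMem hS
  refine ⟨r (max N M), hN _ (le_max_left _ _), hM _ (le_max_right _ _), r, hr, max N M, ?_⟩
  exact hr.connOff fun n hn => hM n ((le_max_right _ _).trans hn)

theorem HasTail.diff_finite {A S : Set V} (hA : HasTail G A) (hS : S.Finite) :
    HasTail G (A \ S) := by
  obtain ⟨r, hr, N, hN⟩ := hA
  obtain ⟨M, hM⟩ := hr.eventually_notMem hS
  exact ⟨r, hr, max N M, fun n hn =>
    ⟨hN _ ((le_max_left _ _).trans hn), hM _ ((le_max_right _ _).trans hn)⟩⟩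

theorem HasTail.image {A : Set V} (hA : HasTail G A) (ψ : Equiv.Perm V)
    (hψ : ∀ x y, G.Adj (ψ x) (ψ y) ↔ G.Adj x y) : HasTail G (ψ '' A) := by
  obtain ⟨r, hr, N, hN⟩ := hA
  exact ⟨fun n => ψ (r n), ⟨ψ.injective.comp hr.1, fun n => (hψ _ _).2 (hr.2 n)⟩, N,
    fun n hn => Set.mem_image_of_mem _ (hN n hn)⟩

/-- A ray is eventually on one of the two sides of a finite separator. -/
theorem HasTail.split {A S C D : Set V} (hA : HasTail G A) (hS : S.Finite)
    (hcov : ∀ v, v ∉ S → v ∈ C ∨ v ∈ D) (hCD : ∀ c ∈ C, ∀ d ∈ D, ¬ G.Adj c d) :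
    HasTail G (A ∩ C) ∨ HasTail G (A ∩ D) := by
  obtain ⟨r, hr, N, hN⟩ := hA
  obtain ⟨M, hM⟩ := hr.eventually_notMem hS
  set K := max N M
  have hK : ∀ n, K ≤ n → r n ∉ S := fun n hn => hM n ((le_max_right _ _).trans hn)
  have hK' : ∀ n, K ≤ n → r n ∈ A := fun n hn => hN n ((le_max_left _ _).trans hn)
  rcases hcov _ (hK K le_rfl) with h | h
  · refine .inl ⟨r, hr, K, fun n hn => ⟨hK' n hn, ?_⟩⟩
    refine (hr.connOff hK n hn).mem_of_closed (fun a ha b hab hb => ?_) h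
    exact (hcov b hb).resolve_right fun hbD => hCD a ha b hbD hab
  · refine .inr ⟨r, hr, K, fun n hn => ⟨hK' n hn, ?_⟩⟩
    refine (hr.connOff hK n hn).mem_of_closed (fun a ha b hab hb => ?_) h
    exact (hcov b hb).resolve_left fun hbC => hCD b hbC a ha hab.symm

/-- `A` has finite neighbourhood, and there are rays on both sides of it. -/
def BigCut (G : SimpleGraph V) (A : Set V) : Prop :=
  (Nbhd G A).Finite ∧ HasTail G A ∧ HasTail G (A ∪ Nbhd G A)ᶜ

theorem compOff_induce_connected {S : Set V} {u : V} (hu : u ∉ S) :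
    (G.induce (compOff G S u)).Connected := by
  have key : ∀ v (hv : ConnOff G S u v),
      (G.induce (compOff G S u)).Reachable ⟨u, .refl hu⟩ ⟨v, hv⟩ := by
    rintro v ⟨h₁, h⟩
    induction h with
    | refl => exact .refl _
    | @tail b c hb h ih =>
      refine ih.trans (SimpleGraph.Adj.reachable ?_)
      simpa using h.1
  rw [SimpleGraph.connected_iff_exists_forall_reachable]
  exact ⟨⟨u, .refl hu⟩, fun v => key v.1 v.2⟩

theorem isCompOf_compOff {S : Set V} {u : V} (hu : u ∉ S) :
    IsCompOf G (compOff G S u) {v | v ∉ S} := by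
  refine ⟨⟨u, .refl hu⟩, fun v hv => ConnOff.right_notMem hv, compOff_induce_connected hu, ?_⟩
  intro C' hC hS hconn
  refine Set.Subset.antisymm (fun v hv => ?_) hC
  obtain ⟨w⟩ := hconn.preconnected ⟨u, hC (.refl hu)⟩ ⟨v, hv⟩
  have : ∀ (a b : C'), (G.induce C').Walk a b → ConnOff G S a b := by
    intro a b w
    induction w with
    | nil => exact .refl (hS (Subtype.coe_prop _))
    | @cons x y z h p ih =>
      exact (ConnOff.of_adj (by simpa using h) (hS x.2) (hS y.2)).trans ih
  exact this _ _ w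

theorem MoreThanOneEnd.exists_bigCut (h : MoreThanOneEnd G) : ∃ A, BigCut G A := by
  obtain ⟨r, r', hr, hr', hne⟩ := h
  unfold RayEquiv at hne
  push Not at hne
  obtain ⟨S, hS⟩ := hne
  obtain ⟨N, hN⟩ := hr.eventually_notMem S.finite_toSet
  obtain ⟨M, hM⟩ := hr'.eventually_notMem S.finite_toSet
  have hA : EventuallyIn r (compOff G S (r N)) := ⟨N, hr.connOff hN⟩
  have hnot := hS _ (isCompOf_compOff (G := G) (hN N le_rfl)) hA
  have hsub : Nbhd G (compOff G S (r N)) ⊆ S := nbhd_compOff_subset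
  refine ⟨compOff G S (r N), S.finite_toSet.subset hsub, ⟨r, hr, hA⟩, r', hr', M, ?_⟩
  rintro n hn (h | h)
  · refine hnot ⟨M, fun m hm => ?_⟩
    exact ConnOff.trans h ((hr'.connOff hM n hn).symm.trans (hr'.connOff hM m hm))
  · exact hM n hn (hsub h)

end Tails

section MinimalSeparators

variable {V : Type u} {G : SimpleGraph V}

/-- A set with rays on both sides whose neighbourhood is as small as possible. -/
def MinCut (G : SimpleGraph V) (A : Set V) : Prop :=
  BigCut G A ∧ ∀ A', BigCut G A' → (Nbhd G A).ncard ≤ (Nbhd G A').ncard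

/-- A vertex set of minimum size among those separating two ends. -/
def MinSep (G : SimpleGraph V) (S : Set V) : Prop := ∃ A, MinCut G A ∧ Nbhd G A = S

/-- All of `T` outside `S` lies in one component of `G` minus `S`. -/
def SepNested (G : SimpleGraph V) (S T : Set V) : Prop :=
  ∀ t ∈ T, t ∉ S → ∀ t' ∈ T, t' ∉ S → ConnOff G S t t'

theorem BigCut.exists_minSep {A : Set V} (hA : BigCut G A) : ∃ S, MinSep G S := by
  classical
  have hex : ∃ n, ∃ A, BigCut G A ∧ (Nbhd G A).ncard = n := ⟨_, A, hA, rfl⟩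
  obtain ⟨B, hB, hn⟩ := Nat.find_spec hex
  refine ⟨_, B, ⟨hB, fun A' hA' => ?_⟩, rfl⟩
  rw [hn]
  exact Nat.find_min' hex ⟨A', hA', rfl⟩

theorem MinSep.finite {S : Set V} (hS : MinSep G S) : S.Finite := by
  obtain ⟨A, hA, rfl⟩ := hS
  exact hA.1.1

theorem MinSep.ncard_le {S A : Set V} (hS : MinSep G S) (hA : BigCut G A) :
    S.ncard ≤ (Nbhd G A).ncard := by
  obtain ⟨B, hB, rfl⟩ := hS
  exact hB.2 A hA

theorem MinSep.ncard_eq {S T : Set V} (hS : MinSep G S) (hT : MinSep G T) :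
    S.ncard = T.ncard := by
  have hS' := hS
  have hT' := hT
  obtain ⟨A, hA, rfl⟩ := hS'
  obtain ⟨B, hB, rfl⟩ := hT'
  exact le_antisymm (hS.ncard_le hB.1) (hT.ncard_le hA.1)

theorem BigCut.exists_compOff {A : Set V} (hA : BigCut G A) :
    ∃ u, u ∉ Nbhd G A ∧ HasTail G (compOff G (Nbhd G A) u) ∧
      ∀ v, ConnOff G (Nbhd G A) u v → v ∈ A := by
  obtain ⟨u, huA, huS, hu⟩ := hA.2.1.exists_compOff hA.1
  exact ⟨u, huS, hu, fun v hv => hv.mem_of_nbhd huA⟩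

theorem BigCut.exists_compOff_compl {A : Set V} (hA : BigCut G A) :
    ∃ u, u ∉ Nbhd G A ∧ HasTail G (compOff G (Nbhd G A) u) ∧
      ∀ v, ConnOff G (Nbhd G A) u v → v ∉ A := by
  obtain ⟨u, huA, huS, hu⟩ := hA.2.2.exists_compOff hA.1
  refine ⟨u, huS, hu, fun v hv hvA => huA (.inl ?_)⟩
  exact hv.symm.mem_of_nbhd hvA

theorem MinSep.exists_other {S : Set V} (hS : MinSep G S) (w : V) :
    ∃ v, v ∉ S ∧ ¬ ConnOff G S w v ∧ HasTail G (compOff G S v) := by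
  obtain ⟨A, hA, rfl⟩ := hS
  obtain ⟨u, hu, hut, huA⟩ := hA.1.exists_compOff
  obtain ⟨v, hv, hvt, hvA⟩ := hA.1.exists_compOff_compl
  by_cases h : ConnOff G (Nbhd G A) w u
  · refine ⟨v, hv, fun h' => ?_, hvt⟩
    exact hvA v (.refl hv) (huA v (h.symm.trans h'))
  · exact ⟨u, hu, h, hut⟩

theorem MinSep.bigCut_compOff {S : Set V} (hS : MinSep G S) {u : V}
    (ht : HasTail G (compOff G S u)) : BigCut G (compOff G S u) := by
  refine ⟨hS.finite.subset nbhd_compOff_subset, ht, ?_⟩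
  obtain ⟨v, hv, hvu, hvt⟩ := hS.exists_other u
  refine hvt.mono fun x hx => ?_
  rintro (h | h)
  · exact hvu (ConnOff.trans h (ConnOff.symm hx))
  · exact ConnOff.right_notMem hx (nbhd_compOff_subset h)

theorem MinSep.nbhd_compOff {S : Set V} (hS : MinSep G S) {u : V}
    (ht : HasTail G (compOff G S u)) : Nbhd G (compOff G S u) = S :=
  Set.eq_of_subset_of_ncard_le nbhd_compOff_subset (hS.ncard_le (hS.bigCut_compOff ht)) hS.finite

theorem MinSep.exists_adj {S : Set V} (hS : MinSep G S) {u : V}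
    (ht : HasTail G (compOff G S u)) {s : V} (hs : s ∈ S) :
    ∃ k, ConnOff G S u k ∧ G.Adj k s := by
  rw [← hS.nbhd_compOff ht] at hs
  exact hs.2

theorem MinSep.sepNested_of_disjoint {S U : Set V} (hS : MinSep G S) {u : V}
    (ht : HasTail G (compOff G S u)) (hU : ∀ k, ConnOff G S u k → k ∉ U) :
    SepNested G U S := by
  intro s hs hsU s' hs' hsU'
  obtain ⟨k, hk, hks⟩ := hS.exists_adj ht hs
  obtain ⟨k', hk', hks'⟩ := hS.exists_adj ht hs'
  have h : ConnOff G U k k' := (hk.symm.trans hk').change fun x hx => hU x (hk.trans hx)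
  exact ((ConnOff.of_adj hks.symm hsU (hU k hk)).trans h).step hks' hsU'

theorem MinCut.sepNested {A U : Set V} (hA : MinCut G A) (hU : ∀ v ∈ U, v ∉ A) :
    SepNested G U (Nbhd G A) := by
  obtain ⟨u, -, hut, huA⟩ := hA.1.exists_compOff
  exact MinSep.sepNested_of_disjoint ⟨A, hA, rfl⟩ hut fun k hk hkU => hU k hkU (huA k hk)

theorem MinCut.sepNested_compl {A U : Set V} (hA : MinCut G A) (hU : ∀ v ∈ U, v ∈ A ∪ Nbhd G A) :
    SepNested G U (Nbhd G A) := by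
  obtain ⟨u, -, hut, huA⟩ := hA.1.exists_compOff_compl
  refine MinSep.sepNested_of_disjoint ⟨A, hA, rfl⟩ hut fun k hk hkU => ?_
  exact (hU k hkU).elim (huA k hk) hk.right_notMem

theorem MinSep.exists_two {S : Set V} (hS : MinSep G S) :
    ∃ u v, HasTail G (compOff G S u) ∧ HasTail G (compOff G S v) ∧ ¬ ConnOff G S u v := by
  obtain ⟨A, hA, rfl⟩ := id hS
  obtain ⟨u, -, hu, -⟩ := hA.1.exists_compOff
  obtain ⟨v, -, hv, hvt⟩ := hS.exists_other u
  exact ⟨u, v, hu, hvt, hv⟩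

theorem MinSep.exists_disjoint {S T : Set V} (hS : MinSep G S) (h : SepNested G S T) :
    ∃ u, HasTail G (compOff G S u) ∧ ∀ k, ConnOff G S u k → k ∉ T := by
  by_contra! hcon
  obtain ⟨u, v, hu, hv, huv⟩ := hS.exists_two
  obtain ⟨k, hk, hkT⟩ := hcon u hu
  obtain ⟨l, hl, hlT⟩ := hcon v hv
  exact huv (hk.trans ((h k hkT hk.right_notMem l hlT hl.right_notMem).trans hl.symm))

theorem MinSep.sepNested_comm {S T : Set V} (hS : MinSep G S) (h : SepNested G S T) :
    SepNested G T S := by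
  obtain ⟨u, hu, hk⟩ := hS.exists_disjoint h
  exact hS.sepNested_of_disjoint hu hk

theorem SepNested.disjoint_side {S T A B : Set V} (h : SepNested G S T)
    (hA : ∀ v ∈ A, v ∉ S) (hB : ∀ v ∈ B, v ∉ S) (hdis : ∀ v ∈ A, v ∉ B)
    (hcl : ∀ a ∈ A, ∀ b, G.Adj a b → b ∉ S → b ∈ A) :
    (∀ v ∈ T, v ∉ A) ∨ ∀ v ∈ T, v ∉ B := by
  by_contra! hcon
  obtain ⟨⟨a, haT, ha⟩, b, hbT, hb⟩ := hcon
  exact hdis b ((h a haT (hA a ha) b hbT (hB b hb)).mem_of_closed hcl ha) hb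

/-- Sets of size `k` avoiding `P` which together with `P` separate `s` from `s'`, and each of
whose elements has neighbours in both components. -/
def tightSeps (G : SimpleGraph V) (s s' : V) (P : Set V) (k : ℕ) : Set (Set V) :=
  {T | T.Finite ∧ T.ncard = k ∧ (∀ t ∈ T, t ∉ P) ∧ s ∉ T ∪ P ∧ s' ∉ T ∪ P ∧
    ¬ ConnOff G (T ∪ P) s s' ∧
    ∀ t ∈ T, (∃ k, ConnOff G (T ∪ P) s k ∧ G.Adj k t) ∧ ∃ k, ConnOff G (T ∪ P) s' k ∧ G.Adj k t}

theorem ConnOff.exists_finite {P : Set V} {s s' : V} (h : ConnOff G P s s') :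
    ∃ W : Set V, W.Finite ∧ ∀ T : Set V, (∀ t ∈ T, t ∉ W) → ConnOff G (T ∪ P) s s' := by
  obtain ⟨hs, h⟩ := h
  induction h with
  | refl =>
    refine ⟨{s}, Set.finite_singleton s, fun T hT => .refl ?_⟩
    rintro (h | h)
    · exact hT s h rfl
    · exact hs h
  | @tail b c _ h ih =>
    obtain ⟨W, hW, hWT⟩ := ih
    refine ⟨insert c W, hW.insert c, fun T hT => ?_⟩
    refine (hWT T fun t ht hw => hT t ht (.inr hw)).step h.1 ?_
    rintro (h' | h')
    · exact hT c h' (.inl rfl)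
    · exact h.2 h'

theorem tightSeps_finite (s s' : V) (k : ℕ) : ∀ P, (tightSeps G s s' P k).Finite := by
  induction k with
  | zero =>
    refine fun P => (Set.finite_singleton (∅ : Set V)).subset ?_
    rintro T ⟨hT, hc, -⟩
    exact (Set.ncard_eq_zero hT).1 hc
  | succ k ih =>
    intro P
    by_cases hP : ConnOff G P s s'
    · obtain ⟨W, hW, hWT⟩ := hP.exists_finite
      refine (hW.biUnion fun p _ => (ih (insert p P)).image (insert p)).subset ?_
      rintro T ⟨hT, hc, hTP, hs, hs', hn, ht⟩
      obtain ⟨p, hpT, hpW⟩ : ∃ p ∈ T, p ∈ W := by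
        by_contra! hcon
        exact hn (hWT T hcon)
      refine Set.mem_biUnion hpW ⟨T \ {p}, ?_, by simp [hpT]⟩
      have hU : T \ {p} ∪ insert p P = T ∪ P := by
        ext x
        by_cases hx : x = p <;> simp [hx, hpT]
      refine ⟨hT.sdiff, ?_, ?_, ?_⟩
      · have := Set.ncard_sdiff_singleton_add_one hpT hT
        omega
      · rintro t ⟨htT, htp⟩ (h | h)
        · exact htp h
        · exact hTP t htT h
      · rw [hU]
        exact ⟨hs, hs', hn, fun t h => ht t h.1⟩
    · refine Set.finite_empty.subset ?_
      rintro T ⟨hT, hc, hTP, hs, hs', hn, ht⟩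
      obtain ⟨t, htT⟩ : T.Nonempty := Set.nonempty_of_ncard_ne_zero (by omega)
      obtain ⟨⟨x, hx, hxt⟩, y, hy, hyt⟩ := ht t htT
      have h₁ := (hx.mono Set.subset_union_right).step hxt (hTP t htT)
      have h₂ := (hy.mono Set.subset_union_right).step hyt (hTP t htT)
      exact hP (h₁.trans h₂.symm)

/-- The minimum separators which are not nested with `S`. -/
def crossing (G : SimpleGraph V) (S : Set V) : Set (Set V) :=
  {U | MinSep G U ∧ ¬ SepNested G U S}

theorem MinSep.crossing_finite {S : Set V} (hS : MinSep G S) : (crossing G S).Finite := by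
  refine (hS.finite.biUnion fun s _ => hS.finite.biUnion fun s' _ =>
    tightSeps_finite (G := G) s s' S.ncard ∅).subset ?_
  rintro T ⟨hT, hTS⟩
  obtain ⟨u, v, hu, hv, huv⟩ := hT.exists_two
  have key : ∀ w, HasTail G (compOff G T w) → ∃ s ∈ S, ConnOff G T w s := by
    intro w hw
    by_contra! hcon
    exact hTS (hS.sepNested_comm (hT.sepNested_of_disjoint hw fun k hk hkS => hcon k hkS hk))
  obtain ⟨s, hs, hus⟩ := key u hu
  obtain ⟨s', hs', hvs⟩ := key v hv
  refine Set.mem_biUnion hs (Set.mem_biUnion hs' ?_)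
  simp only [tightSeps, Set.union_empty]
  refine ⟨hT.finite, hT.ncard_eq hS, by simp, hus.right_notMem, hvs.right_notMem, ?_, ?_⟩
  · exact fun h => huv (hus.trans (h.trans hvs.symm))
  · intro t ht
    obtain ⟨x, hx, hxt⟩ := hT.exists_adj hu ht
    obtain ⟨y, hy, hyt⟩ := hT.exists_adj hv ht
    exact ⟨⟨x, hus.symm.trans hx, hxt⟩, y, hvs.symm.trans hy, hyt⟩

/-- `A` and `B` partition the complement of `S`, without edges between them. -/
structure Sides (G : SimpleGraph V) (S A B : Set V) : Prop where
  cover : ∀ v, v ∉ S → v ∈ A ∨ v ∈ B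
  left : ∀ v ∈ A, v ∉ S
  right : ∀ v ∈ B, v ∉ S
  disj : ∀ v ∈ A, v ∉ B
  noAdj : ∀ a ∈ A, ∀ b ∈ B, ¬ G.Adj a b

theorem Sides.symm {S A B : Set V} (h : Sides G S A B) : Sides G S B A :=
  ⟨fun v hv => (h.cover v hv).symm, h.right, h.left, fun v hB hA => h.disj v hA hB,
    fun a ha b hb hab => h.noAdj b hb a ha hab.symm⟩

theorem Sides.closed {S A B : Set V} (h : Sides G S A B) :
    ∀ a ∈ A, ∀ b, G.Adj a b → b ∉ S → b ∈ A := fun a ha b hab hb =>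
  (h.cover b hb).resolve_right fun hbB => h.noAdj a ha b hbB hab

theorem sides_compl (A : Set V) : Sides G (Nbhd G A) A (A ∪ Nbhd G A)ᶜ := by
  refine ⟨fun v hv => ?_, fun v hv h => h.1 hv, fun v hv h => hv (.inr h),
    fun v hv h => h (.inl hv), fun a ha b hb hab => hb ?_⟩
  · by_cases h : v ∈ A
    · exact .inl h
    · exact .inr fun h' => h'.elim h hv
  · by_cases h : b ∈ A
    · exact .inl h
    · exact .inr ⟨h, a, ha, hab⟩

theorem Sides.nbhd_inter_subset {S T A B C D : Set V} (h : Sides G S A B) (h' : Sides G T C D) :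
    Nbhd G (A ∩ C) ⊆ (S ∩ C) ∪ (T ∩ A) ∪ (S ∩ T) := by
  rintro v ⟨hv, w, ⟨hwA, hwC⟩, hwv⟩
  have h₁ := h.closed w hwA v hwv
  have h₂ := h'.closed w hwC v hwv
  by_cases hS : v ∈ S <;> by_cases hT : v ∈ T <;> simp_all

theorem Sides.minCut_inter {S T A B C D : Set V} (hS : MinSep G S) (hT : MinSep G T)
    (h : Sides G S A B) (h' : Sides G T C D) (hAC : HasTail G (A ∩ C))
    (hBD : HasTail G (B ∩ D)) :
    MinCut G (A ∩ C) ∧ Nbhd G (A ∩ C) = (S ∩ C) ∪ (T ∩ A) ∪ (S ∩ T) ∧ MinCut G (B ∩ D) := by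
  have f₁ := h.nbhd_inter_subset h'
  have f₂ := h.symm.nbhd_inter_subset h'.symm
  have hSf := hS.finite
  have hTf := hT.finite
  set X := (S ∩ C) ∪ (T ∩ A) ∪ (S ∩ T) with hX
  set Y := (S ∩ D) ∪ (T ∩ B) ∪ (S ∩ T) with hY
  have hXf : X.Finite := (hSf.union hTf).subset fun v => by
    simp only [hX, mem_union, mem_inter_iff]; tauto
  have hYf : Y.Finite := (hSf.union hTf).subset fun v => by
    simp only [hY, mem_union, mem_inter_iff]; tauto
  have c₁ : BigCut G (A ∩ C) := by
    refine ⟨hXf.subset f₁, hAC, hBD.mono fun v hv => ?_⟩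
    rintro (hv' | hv')
    · exact h.disj v hv'.1 hv.1
    · rcases f₁ hv' with (h₁ | h₁) | h₁
      · exact h.right v hv.1 h₁.1
      · exact h'.right v hv.2 h₁.1
      · exact h.right v hv.1 h₁.1
  have c₂ : BigCut G (B ∩ D) := by
    refine ⟨hYf.subset f₂, hBD, hAC.mono fun v hv => ?_⟩
    rintro (hv' | hv')
    · exact h.disj v hv.1 hv'.1
    · rcases f₂ hv' with (h₁ | h₁) | h₁
      · exact h.left v hv.1 h₁.1
      · exact h'.left v hv.2 h₁.1
      · exact h.left v hv.1 h₁.1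
  have e₁ := Set.ncard_union_add_ncard_inter X Y hXf hYf
  have e₂ := Set.ncard_union_add_ncard_inter S T hSf hTf
  have e₃ : (X ∪ Y).ncard ≤ (S ∪ T).ncard := Set.ncard_le_ncard (fun v => by
    simp only [hX, hY, mem_union, mem_inter_iff]; tauto) (hSf.union hTf)
  have e₄ : (X ∩ Y).ncard ≤ (S ∩ T).ncard := by
    refine Set.ncard_le_ncard (fun v => ?_) (hSf.inter_of_left T)
    have := h.disj v
    have := h'.disj v
    have := h.left v
    have := h'.left v
    have := h.right v
    have := h'.right v
    simp only [hX, hY, mem_union, mem_inter_iff]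
    tauto
  have e₅ := hS.ncard_le c₁
  have e₆ := hS.ncard_le c₂
  have e₇ := hS.ncard_eq hT
  have e₈ := Set.ncard_le_ncard f₁ hXf
  have e₉ := Set.ncard_le_ncard f₂ hYf
  refine ⟨⟨c₁, fun A' hA' => ?_⟩, Set.eq_of_subset_of_ncard_le f₁ (by omega) hXf,
    ⟨c₂, fun A' hA' => ?_⟩⟩ <;> have := hS.ncard_le hA' <;> omega

theorem Sides.crossing_lt {S T A B C D : Set V} (hS : MinSep G S) (hT : MinSep G T)
    (h : Sides G S A B) (h' : Sides G T C D) (hAC : HasTail G (A ∩ C))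
    (hBD : HasTail G (B ∩ D)) (hST : ¬ SepNested G S T) :
    ∃ S' T', MinSep G S' ∧ MinSep G T' ∧
      (crossing G S').ncard + (crossing G T').ncard <
        (crossing G S).ncard + (crossing G T).ncard := by
  obtain ⟨m₁, n₁, m₂⟩ := h.minCut_inter hS hT h' hAC hBD
  obtain ⟨-, n₂, -⟩ := h.symm.minCut_inter hS hT h'.symm hBD hAC
  have hS' : MinSep G (Nbhd G (A ∩ C)) := ⟨_, m₁, rfl⟩
  have hT' : MinSep G (Nbhd G (B ∩ D)) := ⟨_, m₂, rfl⟩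
  have sU : ∀ U, MinSep G U → SepNested G U S → (∀ v ∈ U, v ∉ A) ∨ ∀ v ∈ U, v ∉ B :=
    fun U hU hn => (hU.sepNested_comm hn).disjoint_side h.left h.right h.disj h.closed
  have tU : ∀ U, MinSep G U → SepNested G U T → (∀ v ∈ U, v ∉ C) ∨ ∀ v ∈ U, v ∉ D :=
    fun U hU hn => (hU.sepNested_comm hn).disjoint_side h'.left h'.right h'.disj h'.closed
  have nA : ∀ U, (∀ v ∈ U, v ∉ A) → SepNested G U (Nbhd G (A ∩ C)) :=
    fun U hU => m₁.sepNested fun v hv hvA => hU v hv hvA.1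
  have nC : ∀ U, (∀ v ∈ U, v ∉ C) → SepNested G U (Nbhd G (A ∩ C)) :=
    fun U hU => m₁.sepNested fun v hv hvA => hU v hv hvA.2
  have nB : ∀ U, (∀ v ∈ U, v ∉ B) → SepNested G U (Nbhd G (B ∩ D)) :=
    fun U hU => m₂.sepNested fun v hv hvA => hU v hv hvA.1
  have nD : ∀ U, (∀ v ∈ U, v ∉ D) → SepNested G U (Nbhd G (B ∩ D)) :=
    fun U hU => m₂.sepNested fun v hv hvA => hU v hv hvA.2
  have nBD : ∀ U, (∀ v ∈ U, v ∉ B) → (∀ v ∈ U, v ∉ D) → SepNested G U (Nbhd G (A ∩ C)) := by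
    refine fun U hB hD => m₁.sepNested_compl fun v hv => ?_
    have h₁ := hB v hv
    have h₂ := hD v hv
    have h₃ := h.cover v
    have h₄ := h'.cover v
    rw [n₁]
    simp only [mem_union, mem_inter_iff]
    tauto
  have nAC : ∀ U, (∀ v ∈ U, v ∉ A) → (∀ v ∈ U, v ∉ C) → SepNested G U (Nbhd G (B ∩ D)) := by
    refine fun U hA hC => m₂.sepNested_compl fun v hv => ?_
    have h₁ := hA v hv
    have h₂ := hC v hv
    have h₃ := h.cover v
    have h₄ := h'.cover v
    rw [n₂]
    simp only [mem_union, mem_inter_iff]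
    tauto
  refine ⟨_, _, hS', hT', ?_⟩
  have e₁ := Set.ncard_union_add_ncard_inter _ _ hS'.crossing_finite hT'.crossing_finite
  have e₂ := Set.ncard_union_add_ncard_inter _ _ hS.crossing_finite hT.crossing_finite
  have e₃ : (crossing G (Nbhd G (A ∩ C)) ∪ crossing G (Nbhd G (B ∩ D))).ncard <
      (crossing G S ∪ crossing G T).ncard := by
    refine Set.ncard_lt_ncard (Set.ssubset_iff_of_subset ?_ |>.2 ⟨S, .inr ⟨hS, hST⟩, ?_⟩)
      (hS.crossing_finite.union hT.crossing_finite)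
    · intro U hU
      by_contra hcon
      have hUm : MinSep G U := hU.elim And.left And.left
      have h₁ : SepNested G U S := by
        by_contra h₁
        exact hcon (.inl ⟨hUm, h₁⟩)
      have h₂ : SepNested G U T := by
        by_contra h₂
        exact hcon (.inr ⟨hUm, h₂⟩)
      have h₃ := sU U hUm h₁
      have h₄ := tU U hUm h₂
      have h₅ := nA U
      have h₆ := nB U
      have h₇ := nC U
      have h₈ := nD U
      have h₉ := nBD U
      have h₀ := nAC U
      rcases hU with ⟨-, hU⟩ | ⟨-, hU⟩ <;> tauto
    · rintro (⟨-, hU⟩ | ⟨-, hU⟩)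
      · exact hU (nA S fun v hv hvA => h.left v hvA hv)
      · exact hU (nB S fun v hv hvB => h.right v hvB hv)
  have e₄ : (crossing G (Nbhd G (A ∩ C)) ∩ crossing G (Nbhd G (B ∩ D))).ncard ≤
      (crossing G S ∩ crossing G T).ncard := by
    refine Set.ncard_le_ncard ?_ (hS.crossing_finite.inter_of_left _)
    rintro U ⟨⟨hUm, h₁⟩, -, h₂⟩
    refine ⟨⟨hUm, fun hn => ?_⟩, hUm, fun hn => ?_⟩
    · exact (sU U hUm hn).elim (fun h' => h₁ (nA U h')) fun h' => h₂ (nB U h')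
    · exact (tU U hUm hn).elim (fun h' => h₁ (nC U h')) fun h' => h₂ (nD U h')
  omega

theorem MinSep.crossing_lt {S T : Set V} (hS : MinSep G S) (hT : MinSep G T)
    (hST : ¬ SepNested G S T) :
    ∃ S' T', MinSep G S' ∧ MinSep G T' ∧
      (crossing G S').ncard + (crossing G T').ncard <
        (crossing G S).ncard + (crossing G T).ncard := by
  obtain ⟨A, hA, rfl⟩ := id hS
  obtain ⟨C, hC, rfl⟩ := id hT
  have hs := sides_compl (G := G) A
  have ht := sides_compl (G := G) C
  have hB := hA.1.2.2
  have hD := hC.1.2.2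
  have hC' := hC.1.2.1
  generalize (A ∪ Nbhd G A)ᶜ = B at hs hB
  generalize (C ∪ Nbhd G C)ᶜ = D at ht hD
  have key : (HasTail G (A ∩ C) ∧ HasTail G (B ∩ D)) ∨ HasTail G (A ∩ D) ∧ HasTail G (B ∩ C) := by
    have h₁ := hA.1.2.1.split hT.finite ht.cover ht.noAdj
    have h₂ := hB.split hT.finite ht.cover ht.noAdj
    have h₃ := hC'.split hS.finite hs.cover hs.noAdj
    have h₄ := hD.split hS.finite hs.cover hs.noAdj
    rw [Set.inter_comm C A, Set.inter_comm C B] at h₃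
    rw [Set.inter_comm D A, Set.inter_comm D B] at h₄
    tauto
  rcases key with ⟨h₁, h₂⟩ | ⟨h₁, h₂⟩
  · exact hs.crossing_lt hS hT ht h₁ h₂ hST
  · exact hs.crossing_lt hS hT ht.symm h₁ h₂ hST

/-- `ψ` preserves adjacency. -/
def IsAut (G : SimpleGraph V) (ψ : Equiv.Perm V) : Prop := ∀ x y, G.Adj (ψ x) (ψ y) ↔ G.Adj x y

theorem IsAut.symm {ψ : Equiv.Perm V} (hψ : IsAut G ψ) : IsAut G ψ.symm := fun x y => by
  rw [← hψ]
  simp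

theorem BigCut.image {A : Set V} (hA : BigCut G A) {ψ : Equiv.Perm V} (hψ : IsAut G ψ) :
    BigCut G (ψ '' A) := by
  refine ⟨?_, hA.2.1.image ψ hψ, ?_⟩
  · rw [nbhd_image ψ hψ]
    exact hA.1.image ψ
  · rw [nbhd_image ψ hψ, ← Set.image_union, ← Set.image_compl_eq ψ.bijective]
    exact hA.2.2.image ψ hψ

theorem MinSep.image {S : Set V} (hS : MinSep G S) {ψ : Equiv.Perm V} (hψ : IsAut G ψ) :
    MinSep G (ψ '' S) := by
  obtain ⟨A, hA, rfl⟩ := hS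
  refine ⟨ψ '' A, ⟨hA.1.image hψ, fun A' hA' => ?_⟩, nbhd_image ψ hψ⟩
  rw [nbhd_image ψ hψ, Set.ncard_image_of_injective _ ψ.injective]
  exact hA.2 A' hA'

theorem SepNested.image {S T : Set V} (h : SepNested G S T) {ψ : Equiv.Perm V} (hψ : IsAut G ψ) :
    SepNested G (ψ '' S) (ψ '' T) := by
  rintro _ ⟨t, ht, rfl⟩ htS _ ⟨t', ht', rfl⟩ htS'
  rw [connOff_image_iff ψ hψ]
  exact h t ht (fun h => htS ⟨t, h, rfl⟩) t' ht' fun h => htS' ⟨t', h, rfl⟩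

theorem MinSep.crossing_image_le {S : Set V} (hS : MinSep G S) {ψ : Equiv.Perm V}
    (hψ : IsAut G ψ) : (crossing G (ψ '' S)).ncard ≤ (crossing G S).ncard := by
  rw [← Set.ncard_image_of_injective (crossing G S) (Set.image_injective.2 ψ.injective)]
  refine Set.ncard_le_ncard ?_ (hS.crossing_finite.image _)
  rintro U ⟨hU, hUS⟩
  have e : ψ '' (ψ.symm '' U) = U := by simp [← Set.image_comp]
  refine ⟨ψ.symm '' U, ⟨hU.image hψ.symm, fun hn => hUS ?_⟩, e⟩
  have := hn.image hψ
  rwa [e] at this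

/-- The minimum separators crossing as few others as possible. -/
def optSeps (G : SimpleGraph V) : Set (Set V) :=
  {S | MinSep G S ∧ ∀ T, MinSep G T → (crossing G S).ncard ≤ (crossing G T).ncard}

theorem MinSep.optSeps_nonempty {S : Set V} (hS : MinSep G S) : (optSeps G).Nonempty := by
  classical
  have hex : ∃ n, ∃ S, MinSep G S ∧ (crossing G S).ncard = n := ⟨_, S, hS, rfl⟩
  obtain ⟨T, hT, hn⟩ := Nat.find_spec hex
  refine ⟨T, hT, fun U hU => ?_⟩
  rw [hn]
  exact Nat.find_min' hex ⟨U, hU, rfl⟩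

theorem optSeps_nested {S T : Set V} (hS : S ∈ optSeps G) (hT : T ∈ optSeps G) :
    SepNested G S T := by
  by_contra h
  obtain ⟨S', T', hS', hT', hlt⟩ := hS.1.crossing_lt hT.1 h
  have := hS.2 S' hS'
  have := hT.2 T' hT'
  omega

theorem optSeps_image {S : Set V} (hS : S ∈ optSeps G) {ψ : Equiv.Perm V} (hψ : IsAut G ψ) :
    ψ '' S ∈ optSeps G :=
  ⟨hS.1.image hψ, fun T hT => (hS.1.crossing_image_le hψ).trans (hS.2 T hT)⟩

theorem MinSep.nonempty {S : Set V} (hS : MinSep G S) (hG : G.Connected) : S.Nonempty := by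
  by_contra hne
  rw [Set.not_nonempty_iff_eq_empty] at hne
  subst hne
  obtain ⟨u, v, -, -, huv⟩ := hS.exists_two
  obtain ⟨w⟩ := hG.preconnected u v
  have : ∀ (a b : V), G.Walk a b → ConnOff G ∅ a b := by
    intro a b w
    induction w with
    | nil => exact .refl (Set.notMem_empty _)
    | cons h p ih => exact (ConnOff.of_adj h (Set.notMem_empty _) (Set.notMem_empty _)).trans ih
  exact huv (this u v w)

theorem optSeps_hasTail (hG : G.Connected) (htr : ∀ x y, ∃ ψ : Equiv.Perm V, IsAut G ψ ∧ ψ x = y)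
    {S : Set V} (hS : S ∈ optSeps G) {u : V} (hu : u ∉ S) : HasTail G (compOff G S u) := by
  obtain ⟨s, hs⟩ := hS.1.nonempty hG
  obtain ⟨ψ, hψ, rfl⟩ := htr s u
  have hT := optSeps_image hS hψ
  have huT : ψ s ∈ ψ '' S := Set.mem_image_of_mem _ hs
  generalize ψ '' S = T at hT huT
  obtain ⟨l, hl, hlS⟩ := hT.1.exists_disjoint (optSeps_nested hT hS)
  obtain ⟨k, hk, hku⟩ := hT.1.exists_adj hl huT
  refine hl.mono fun x hx => ?_
  refine (ConnOff.of_adj hku.symm hu (hlS k hk)).trans ?_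
  exact (hk.symm.trans hx).change fun y hy => hlS y (hk.trans hy)

/-- A system of pairwise nested separators of the same size, closed under automorphisms, such that
every component is adjacent to every vertex of the separator. -/
structure SepSystem (G : SimpleGraph V) (𝒰 : Set (Set V)) : Prop where
  nonempty : 𝒰.Nonempty
  image : ∀ S ∈ 𝒰, ∀ ψ : Equiv.Perm V, IsAut G ψ → ψ '' S ∈ 𝒰
  finite : ∀ S ∈ 𝒰, S.Finite
  nonempty_of_mem : ∀ S ∈ 𝒰, S.Nonempty
  ncard_eq : ∀ S ∈ 𝒰, ∀ T ∈ 𝒰, S.ncard = T.ncard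
  exists_other : ∀ S ∈ 𝒰, ∀ u, ∃ v, v ∉ S ∧ ¬ ConnOff G S u v
  exists_adj : ∀ S ∈ 𝒰, ∀ u, u ∉ S → ∀ s ∈ S, ∃ k, ConnOff G S u k ∧ G.Adj k s
  ncard_le : ∀ S ∈ 𝒰, ∀ u, u ∉ S → ∀ b, S.ncard ≤ (Nbhd G (compOff G S u \ {b})).ncard
  nested : ∀ S ∈ 𝒰, ∀ T ∈ 𝒰, SepNested G S T

theorem exists_sepSystem (hG : G.Connected) (hends : MoreThanOneEnd G)
    (htr : ∀ x y, ∃ ψ : Equiv.Perm V, IsAut G ψ ∧ ψ x = y) : ∃ 𝒰, SepSystem G 𝒰 := by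
  obtain ⟨A, hA⟩ := hends.exists_bigCut
  obtain ⟨S₀, hS₀⟩ := hA.exists_minSep
  refine ⟨optSeps G, hS₀.optSeps_nonempty, fun S hS ψ hψ => optSeps_image hS hψ,
    fun S hS => hS.1.finite, fun S hS => hS.1.nonempty hG, fun S hS T hT => hS.1.ncard_eq hT.1,
    fun S hS u => ?_, fun S hS u hu s hs => ?_, fun S hS u hu b => ?_,
    fun S hS T hT => optSeps_nested hS hT⟩
  · obtain ⟨v, hv, huv, -⟩ := hS.1.exists_other u
    exact ⟨v, hv, huv⟩
  · exact hS.1.exists_adj (optSeps_hasTail hG htr hS hu) hs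
  · have hB := hS.1.bigCut_compOff (optSeps_hasTail hG htr hS hu)
    have hsub : Nbhd G (compOff G S u \ {b}) ⊆ insert b (Nbhd G (compOff G S u)) := by
      rintro v ⟨hv, w, hw, hwv⟩
      by_cases hvb : v = b
      · exact .inl hvb
      · exact .inr ⟨fun h => hv ⟨h, hvb⟩, w, hw.1, hwv⟩
    refine hS.1.ncard_le ⟨(hB.1.insert b).subset hsub, hB.2.1.diff_finite (Set.finite_singleton b),
      (hB.2.2.diff_finite (Set.finite_singleton b)).mono ?_⟩
    rintro v ⟨hv, hvb⟩ (h | h)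
    · exact hv (.inl h.1)
    · exact (hsub h).elim hvb fun h' => hv (.inr h')

/-- How the components of two nested separators relate. -/
theorem SepSystem.exists_pair {𝒰 : Set (Set V)} (h𝒰 : SepSystem G 𝒰) {S T : Set V} (hS : S ∈ 𝒰)
    (hT : T ∈ 𝒰) (hne : S ≠ T) : ∃ m ∈ T, ∃ n ∈ S, m ∉ S ∧ n ∉ T ∧
      (∀ t ∈ T, t ∉ S → ConnOff G S m t) ∧ (∀ s ∈ S, s ∉ T → ConnOff G T n s) ∧
      (∀ v, v ∉ S → ¬ ConnOff G S m v → ConnOff G T n v) ∧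
      ∀ v, v ∉ T → ¬ ConnOff G T n v → ConnOff G S m v := by
  have key : ∀ S ∈ 𝒰, ∀ T ∈ 𝒰, S ≠ T → ∃ m ∈ T, m ∉ S := by
    intro S hS T hT hne
    by_contra! hcon
    exact hne (Set.eq_of_subset_of_ncard_le hcon (h𝒰.ncard_eq S hS T hT).le (h𝒰.finite S hS)).symm
  have key' : ∀ S ∈ 𝒰, ∀ T ∈ 𝒰, ∀ m ∈ T, m ∉ S → ∀ n ∈ S, n ∉ T →
      ∀ v, v ∉ S → ¬ ConnOff G S m v → ConnOff G T n v := by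
    intro S hS T hT m hm hmS n hn hnT v hv hmv
    have hdis : ∀ k, ConnOff G S v k → k ∉ T := fun k hk hkT =>
      hmv ((h𝒰.nested S hS T hT m hm hmS k hkT hk.right_notMem).trans hk.symm)
    obtain ⟨k, hk, hkn⟩ := h𝒰.exists_adj S hS v hv n hn
    exact ((hk.change hdis).step hkn hnT).symm
  obtain ⟨m, hm, hmS⟩ := key S hS T hT hne
  obtain ⟨n, hn, hnT⟩ := key T hT S hS hne.symm
  exact ⟨m, hm, n, hn, hmS, hnT, fun t => h𝒰.nested S hS T hT m hm hmS t,
    fun s => h𝒰.nested T hT S hS n hn hnT s, key' S hS T hT m hm hmS n hn hnT,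
    key' T hT S hS n hn hnT m hm hmS⟩

end MinimalSeparators

section Digraphs

variable {V : Type u} {E : V → V → Prop}

theorem ug_adj (hD : IsDigraph E) {x y : V} : (UG E).Adj x y ↔ E x y ∨ E y x := by
  simp only [UG, SimpleGraph.fromRel_adj, and_iff_right_iff_imp]
  rintro h rfl
  exact h.elim (hD.1 x) (hD.1 x)

theorem ug_flip : UG (flip E) = UG E := by
  ext x y
  simp only [UG, SimpleGraph.fromRel_adj, flip, or_comm]

/-- `ψ` is an automorphism of the digraph `E`. -/
def IsDiAut (E : V → V → Prop) (ψ : Equiv.Perm V) : Prop := ∀ x y, E (ψ x) (ψ y) ↔ E x y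

theorem IsDiAut.isAut {ψ : Equiv.Perm V} (hψ : IsDiAut E ψ) : IsAut (UG E) ψ := fun x y => by
  simp [UG, SimpleGraph.fromRel_adj, hψ x y, hψ y x]

theorem DigraphCHom.extend (hhom : DigraphCHom E) {X : Set V} (hX : X.Finite)
    (hc : ((UG E).induce X).Connected) (f : V → V) (hf : InjOn f X)
    (hE : ∀ a ∈ X, ∀ b ∈ X, E a b ↔ E (f a) (f b)) :
    ∃ ψ, IsDiAut E ψ ∧ ∀ a ∈ X, ψ a = f a := by
  obtain ⟨ψ, hψ, h⟩ := hhom X (f '' X) hX (hX.image f) hc (Equiv.Set.imageOfInjOn f X hf)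
    fun a b => hE a a.2 b b.2
  exact ⟨ψ, hψ, fun a ha => h ⟨a, ha⟩⟩

theorem star_connected {G : SimpleGraph V} {c : V} {X : Set V} (hX : ∀ x ∈ X, G.Adj c x) :
    (G.induce (insert c X)).Connected := by
  rw [SimpleGraph.connected_iff_exists_forall_reachable]
  refine ⟨⟨c, .inl rfl⟩, ?_⟩
  rintro ⟨x, rfl | hx⟩
  · exact .refl _
  · exact SimpleGraph.Adj.reachable (by simpa using hX x hx)

theorem not_adj_of_adj (htf : ¬ HasTriangle E) {c x y : V} (hx : (UG E).Adj c x)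
    (hy : (UG E).Adj c y) : ¬ (UG E).Adj x y := fun h => htf ⟨c, x, y, hx, h, hy⟩

theorem star_extend (hD : IsDigraph E) (hhom : DigraphCHom E) (htf : ¬ HasTriangle E)
    (c c' : V) {X : Set V} (hX : X.Finite) (f : V → V) (hf : InjOn f X)
    (hE : ∀ x ∈ X, (E c x ∧ E c' (f x)) ∨ (E x c ∧ E (f x) c')) :
    ∃ ψ, IsDiAut E ψ ∧ ψ c = c' ∧ ∀ x ∈ X, ψ x = f x := by
  classical
  have hadj : ∀ x ∈ X, (UG E).Adj c x := fun x hx =>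
    (ug_adj hD).2 ((hE x hx).imp And.left And.left)
  have hadj' : ∀ x ∈ X, (UG E).Adj c' (f x) := fun x hx =>
    (ug_adj hD).2 ((hE x hx).imp And.right And.right)
  have hcX : ∀ x ∈ X, x ≠ c := fun x hx => (hadj x hx).ne'
  obtain ⟨ψ, hψ, h⟩ := hhom.extend (hX.insert c) (star_connected hadj)
    (fun z => if z = c then c' else f z) (by
      rintro x hx y hy hxy
      rcases hx with rfl | hx <;> rcases hy with rfl | hy
      · rfl
      · simp only [if_true, hcX y hy, if_false] at hxy
        exact absurd hxy (hadj' y hy).ne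
      · simp only [if_true, hcX x hx, if_false] at hxy
        exact absurd hxy (hadj' x hx).ne'
      · simp only [hcX x hx, hcX y hy, if_false] at hxy
        exact hf hx hy hxy) (by
      have key : ∀ x ∈ X, (E c x ↔ E c' (f x)) ∧ (E x c ↔ E (f x) c') := by
        intro x hx
        have h₁ := hD.2 c x
        have h₂ := hD.2 c' (f x)
        have h₃ := hE x hx
        tauto
      rintro x hx y hy
      rcases hx with rfl | hx <;> rcases hy with rfl | hy
      · simp [hD.1]
      · simpa only [if_true, hcX y hy, if_false] using (key y hy).1
      · simpa only [if_true, hcX x hx, if_false] using (key x hx).2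
      · simp only [hcX x hx, hcX y hy, if_false]
        have h₁ := not_adj_of_adj htf (hadj x hx) (hadj y hy)
        have h₂ := not_adj_of_adj htf (hadj' x hx) (hadj' y hy)
        rw [ug_adj hD] at h₁ h₂
        tauto)
  refine ⟨ψ, hψ, by simpa using h c (.inl rfl), fun x hx => ?_⟩
  rw [h x (.inr hx), if_neg (hcX x hx)]

/-- A relation on the edges which is invariant along alternating walks. -/
def AltInvariant (E F : V → V → Prop) : Prop :=
  (∀ u v v', E u v → E u v' → F u v → F u v') ∧ ∀ u u' v, E u v → E u' v → F u v → F u' v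

theorem AltInvariant.reach (hD : IsDigraph E) {F : V → V → Prop} (hF : AltInvariant E F)
    {e f : V × V} (he : E e.1 e.2) (hf : E f.1 f.2) (hr : Reach E e f) :
    F e.1 e.2 ↔ F f.1 f.2 := by
  obtain ⟨n, w, ⟨hw, halt⟩, ⟨i, hi, hie⟩, ⟨j, hj, hjf⟩⟩ := hr
  let P : ℕ → Prop := fun i =>
    (E (w i) (w (i + 1)) ∧ F (w i) (w (i + 1))) ∨ (E (w (i + 1)) (w i) ∧ F (w (i + 1)) (w i))
  have hP : ∀ i, i + 2 ≤ n → (P i ↔ P (i + 1)) := by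
    intro i hi
    have h₁ := halt i hi
    have h₂ := hw i (by omega)
    have h₃ := hw (i + 1) (by omega)
    simp only [P, show i + 1 + 1 = i + 2 from rfl] at h₃ ⊢
    rcases h₂ with h | h
    · have h' := h₁.1 h
      simp only [h, h', hD.2 _ _ h, hD.2 _ _ h', true_and, false_and, or_false, false_or]
      exact ⟨hF.2 _ _ _ h h', hF.2 _ _ _ h' h⟩
    · have hn := hD.2 _ _ h
      have h' := h₃.resolve_right fun h₄ => hn (h₁.2 h₄)
      simp only [h, h', hD.2 _ _ h, hD.2 _ _ h', true_and, false_and, or_false, false_or]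
      exact ⟨hF.1 _ _ _ h h', hF.1 _ _ _ h' h⟩
  have hP₀ : ∀ i, i < n → (P i ↔ P 0) := by
    intro i
    induction i with
    | zero => exact fun _ => Iff.rfl
    | succ i ih => exact fun hi => (hP i (by omega)).symm.trans (ih (by omega))
  have hedge : ∀ i, ∀ e : V × V, E e.1 e.2 →
      ((w i = e.1 ∧ w (i + 1) = e.2) ∨ (w i = e.2 ∧ w (i + 1) = e.1)) → (P i ↔ F e.1 e.2) := by
    rintro i e he h
    have := hD.2 _ _ he
    simp only [P]
    rcases h with ⟨h₁, h₂⟩ | ⟨h₁, h₂⟩ <;> rw [h₁, h₂] <;> tauto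
  rw [← hedge i e he hie, ← hedge j f hf hjf, hP₀ i hi, hP₀ j hj]

theorem exists_two_arc {e : V × V} (hcyc : ∃ v, ∃ w : (DeltaGraph E e).Walk v v, Odd w.length) :
    ∃ u v y, DeltaRel E e u v ∧ DeltaRel E e v y := by
  classical
  by_contra! hcon
  obtain ⟨v, w, hw⟩ := hcyc
  let c : (DeltaGraph E e).Coloring Bool :=
    SimpleGraph.Coloring.mk (fun x => decide (x ∈ Tails E e)) (by
      intro a b hab hc
      have hc' : a ∈ Tails E e ↔ b ∈ Tails E e := by simpa using hc
      simp only [DeltaGraph, UG, SimpleGraph.fromRel_adj] at hab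
      rcases hab.2 with h | h
      · obtain ⟨z, hz⟩ := hc'.1 ⟨b, h⟩
        exact hcon a b z h hz
      · obtain ⟨z, hz⟩ := hc'.2 ⟨a, h⟩
        exact hcon b a z h hz)
  rw [← Nat.not_even_iff_odd] at hw
  exact hw ((c.even_length_iff_congr w).2 Iff.rfl)

/-- A C-homogeneous triangle-free digraph without sources and sinks all of whose edges are
reachable from each other. -/
structure HomDigraph (E : V → V → Prop) : Prop where
  isDigraph : IsDigraph E
  hom : DigraphCHom E
  tf : ¬ HasTriangle E
  reach : ∀ F, AltInvariant E F → ∀ u v x y, E u v → E x y → F u v → F x y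
  exists_out : ∀ v, ∃ y, E v y
  exists_in : ∀ v, ∃ y, E y v

theorem homDigraph_of_two_arc (hD : IsDigraph E) (hconn : (UG E).Connected) (hhom : DigraphCHom E)
    (htf : ¬ HasTriangle E) {e : V × V} (he : E e.1 e.2) {u v y : V} (huv : DeltaRel E e u v)
    (hvy : DeltaRel E e v y) : HomDigraph E := by
  have hvert : ∀ x, ∃ ψ, IsDiAut E ψ ∧ ψ v = x := fun x => by
    obtain ⟨ψ, hψ, h, -⟩ := star_extend hD hhom htf v x Set.finite_empty id (by simp) (by simp)
    exact ⟨ψ, hψ, h⟩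
  have htwo : ∀ F, AltInvariant E F → ∀ a b c, E a b → E b c → (F a b ↔ F b c) := by
    classical
    intro F hF a b c hab hbc
    have huy : u ≠ y := by
      rintro rfl
      exact hD.2 _ _ huv.1 hvy.1
    have hac : a ≠ c := by
      rintro rfl
      exact hD.2 _ _ hab hbc
    obtain ⟨ψ, hψ, hv, h⟩ := star_extend hD hhom htf v b (X := {u, y}) (Set.toFinite _)
      (fun z => if z = u then a else c) (by
        rintro p (rfl | rfl) q (rfl | rfl) <;> simp [huy.symm, hac, hac.symm])
      (by
        rintro p (rfl | rfl)
        · exact .inr ⟨huv.1, by simpa using hab⟩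
        · exact .inl ⟨hvy.1, by simpa [huy.symm] using hbc⟩)
    have hu : ψ u = a := by simpa using h u (.inl rfl)
    have hy : ψ y = c := by simpa [huy.symm] using h y (.inr rfl)
    have hF' : AltInvariant E fun p q => F (ψ p) (ψ q) :=
      ⟨fun p q q' h h' => hF.1 _ _ _ ((hψ _ _).2 h) ((hψ _ _).2 h'),
        fun p p' q h h' => hF.2 _ _ _ ((hψ _ _).2 h) ((hψ _ _).2 h')⟩
    have h₁ := hF'.reach hD he huv.1 huv.2
    have h₂ := hF'.reach hD he hvy.1 hvy.2
    simp only [hu, hv, hy] at h₁ h₂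
    exact h₁.symm.trans h₂
  refine ⟨hD, hhom, htf, fun F hF p q x z hpq hxz hFpq => ?_, fun x => ?_, fun x => ?_⟩
  · let P : V → Prop := fun x => (∀ y, E x y → F x y) ∧ ∀ y, E y x → F y x
    have hP₁ : ∀ a b, E a b → F a b → P a := fun a b hab h =>
      ⟨fun c hac => hF.1 a b c hab hac h, fun c hca => (htwo F hF c a b hca hab).2 h⟩
    have hP₂ : ∀ a b, E a b → F a b → P b := fun a b hab h =>
      ⟨fun c hbc => (htwo F hF a b c hab hbc).1 h, fun c hcb => hF.2 a c b hab hcb h⟩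
    have hw : ∀ a b, (UG E).Walk a b → P a → P b := by
      intro a b w
      induction w with
      | nil => exact id
      | cons h _ ih =>
        refine fun ha => ih ?_
        rcases (ug_adj hD).1 h with h | h
        · exact hP₂ _ _ h (ha.1 _ h)
        · exact hP₁ _ _ h (ha.2 _ h)
    obtain ⟨w⟩ := hconn.preconnected p x
    exact (hw p x w (hP₁ p q hpq hFpq)).1 z hxz
  · obtain ⟨ψ, hψ, rfl⟩ := hvert x
    exact ⟨ψ y, (hψ _ _).2 hvy.1⟩
  · obtain ⟨ψ, hψ, rfl⟩ := hvert x
    exact ⟨ψ u, (hψ _ _).2 huv.1⟩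

namespace HomDigraph

theorem dual (h : HomDigraph E) : HomDigraph (flip E) := by
  refine ⟨⟨h.isDigraph.1, fun x y => h.isDigraph.2 y x⟩, ?_, ?_,
    fun F hF u v x y huv hxy hFuv => ?_,
    h.exists_in, h.exists_out⟩
  · intro X Y hX hY hc φ hφ
    rw [ug_flip] at hc
    obtain ⟨ψ, hψ, hψφ⟩ := h.hom X Y hX hY hc φ fun a b => hφ b a
    exact ⟨ψ, fun x y => hψ y x, hψφ⟩
  · have := h.tf
    unfold HasTriangle at this ⊢
    rwa [ug_flip]
  · exact h.reach (fun a b => F b a) ⟨fun a b b' h₁ h₂ => hF.2 b b' a h₁ h₂,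
      fun a a' b h₁ h₂ => hF.1 b a a' h₁ h₂⟩ v u y x huv hxy hFuv

theorem adj_iff (h : HomDigraph E) {x y : V} : (UG E).Adj x y ↔ E x y ∨ E y x :=
  ug_adj h.isDigraph

theorem vertex_trans (h : HomDigraph E) (x y : V) : ∃ ψ, IsDiAut E ψ ∧ ψ x = y := by
  obtain ⟨ψ, hψ, hx, -⟩ :=
    star_extend h.isDigraph h.hom h.tf x y Set.finite_empty id (by simp) (by simp)
  exact ⟨ψ, hψ, hx⟩

theorem edge_trans (h : HomDigraph E) {x y a b : V} (hxy : E x y) (hab : E a b) :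
    ∃ ψ, IsDiAut E ψ ∧ ψ x = a ∧ ψ y = b := by
  obtain ⟨ψ, hψ, hx, hy⟩ := star_extend h.isDigraph h.hom h.tf x a (Set.finite_singleton y)
    (fun _ => b) (by simp) (by simp [hxy, hab])
  exact ⟨ψ, hψ, hx, hy y rfl⟩

theorem exists_out_ne (h : HomDigraph E) (v b : V) : ∃ a, a ≠ b ∧ E v a := by
  by_contra! hcon
  obtain ⟨w, hw⟩ := h.exists_out v
  have huniq : ∀ x a c, E x a → E x c → a = c := by
    intro x a c ha hc
    obtain ⟨ψ, hψ, hx⟩ := h.vertex_trans x v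
    refine ψ.injective ?_
    have key : ∀ a, E x a → ψ a = b := fun a ha => by
      by_contra hne
      exact hcon _ hne (hx ▸ (hψ x a).2 ha)
    rw [key a ha, key c hc]
  obtain ⟨z, hz⟩ := h.exists_out w
  have hzw := h.reach (fun _ y => y = w) ⟨fun a c c' h₁ h₂ h₃ => (huniq a c' c h₂ h₁).trans h₃,
    fun _ _ _ _ _ => id⟩ v w w z hw hz rfl
  exact h.isDigraph.1 w (hzw ▸ hz)

theorem exists_in_ne (h : HomDigraph E) (v b : V) : ∃ a, a ≠ b ∧ E a v :=
  h.dual.exists_out_ne v b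

/-- Both edges `s p` and `s q` point away from `s`, or both point towards `s`. -/
def SameDir (E : V → V → Prop) (s p q : V) : Prop := (E s p ∧ E s q) ∨ (E p s ∧ E q s)

/-- Two neighbours of `s` of the same direction can be interchanged while fixing `s` and finitely
many further neighbours. -/
theorem exists_swap (h : HomDigraph E) {s p q : V} (hpq : SameDir E s p q) {X : Set V}
    (hX : X.Finite) (hXs : ∀ x ∈ X, (UG E).Adj s x) (hp : p ∉ X) (hq : q ∉ X) :
    ∃ ψ, IsDiAut E ψ ∧ ψ s = s ∧ ψ p = q ∧ ψ q = p ∧ ∀ x ∈ X, ψ x = x := by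
  classical
  have hfix : ∀ x ∈ X, Equiv.swap p q x = x := fun x hx =>
    Equiv.swap_apply_of_ne_of_ne (fun e => hp (e ▸ hx)) fun e => hq (e ▸ hx)
  obtain ⟨ψ, hψ, hs, hψX⟩ := star_extend h.isDigraph h.hom h.tf s s
    ((hX.insert q).insert p) (Equiv.swap p q) (Equiv.injective _).injOn (by
      rintro x (rfl | rfl | hx)
      · rw [Equiv.swap_apply_left]
        exact hpq
      · rw [Equiv.swap_apply_right]
        exact hpq.imp And.symm And.symm
      · rw [hfix x hx]
        simpa using h.adj_iff.1 (hXs x hx))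
  refine ⟨ψ, hψ, hs, ?_, ?_, fun x hx => ?_⟩
  · rw [hψX p (.inl rfl), Equiv.swap_apply_left]
  · rw [hψX q (.inr (.inl rfl)), Equiv.swap_apply_right]
  · rw [hψX x (.inr (.inr hx)), hfix x hx]

end HomDigraph

end Digraphs

section LocalStructure

variable {V : Type u} {E : V → V → Prop} {𝒰 : Set (Set V)}

theorem SepSystem.exists_nbr {G : SimpleGraph V} (h𝒰 : SepSystem G 𝒰) {S : Set V} (hS : S ∈ 𝒰)
    {s : V} (hs : s ∈ S) (u : V) : ∃ x, G.Adj s x ∧ x ∉ S ∧ ¬ ConnOff G S u x := by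
  obtain ⟨v, hv, huv⟩ := h𝒰.exists_other S hS u
  obtain ⟨x, hx, hxs⟩ := h𝒰.exists_adj S hS v hv s hs
  exact ⟨x, hxs.symm, hx.right_notMem, fun h => huv (h.trans hx.symm)⟩

theorem IsDiAut.adj_iff {ψ : Equiv.Perm V} (hψ : IsDiAut E ψ) {x y : V} :
    (UG E).Adj (ψ x) (ψ y) ↔ (UG E).Adj x y := hψ.isAut x y

theorem IsDiAut.connOff_iff {ψ : Equiv.Perm V} (hψ : IsDiAut E ψ) {S : Set V} {x y : V} :
    ConnOff (UG E) (ψ '' S) (ψ x) (ψ y) ↔ ConnOff (UG E) S x y :=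
  connOff_image_iff ψ hψ.isAut

namespace HomDigraph

theorem out_mem_of_edge (h : HomDigraph E) (h𝒰 : SepSystem (UG E) 𝒰) {S : Set V} (hS : S ∈ 𝒰)
    {s s' y : V} (hs : s ∈ S) (hs' : s' ∈ S) (hss : E s s') (hsy : E s y) : y ∈ S := by
  by_contra hy
  obtain ⟨x, hsx, hxS, hyx⟩ := h𝒰.exists_nbr hS hs y
  have hxs' : s' ∉ ({x} : Set V) := fun e => hxS (e ▸ hs')
  have hxy : y ∉ ({x} : Set V) := fun e => hyx (e ▸ .refl hy)
  obtain ⟨ψ, hψ, h₁, h₂, h₃, h₄⟩ := h.exists_swap (.inl ⟨hss, hsy⟩) (Set.finite_singleton x)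
    (fun z hz => hz ▸ hsx) hxs' hxy
  have h₅ : ψ x = x := h₄ x rfl
  have hT := h𝒰.image S hS ψ hψ.isAut
  have hyT : y ∈ ψ '' S := ⟨s', hs', h₂⟩
  have hsT : s' ∉ ψ '' S := by
    rw [← h₃, ψ.injective.mem_set_image]
    exact hy
  have hne : S ≠ ψ '' S := fun e => hsT (e ▸ hs')
  obtain ⟨m, -, n, -, -, -, hm, hn, hmn, -⟩ := h𝒰.exists_pair hS hT hne
  have hnx := hmn x hxS fun hmx => hyx ((hm y hyT hy).symm.trans hmx)
  have hsx' := (hn s' hs' hsT).symm.trans hnx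
  rw [← h₃, ← h₅, hψ.connOff_iff] at hsx'
  exact hyx hsx'

theorem dual_sys (h𝒰 : SepSystem (UG E) 𝒰) : SepSystem (UG (flip E)) 𝒰 := ug_flip (E := E) ▸ h𝒰

theorem indep (h : HomDigraph E) (h𝒰 : SepSystem (UG E) 𝒰) {S : Set V} (hS : S ∈ 𝒰)
    {s s' : V} (hs : s ∈ S) (hs' : s' ∈ S) : ¬ (UG E).Adj s s' := by
  have key : ∀ s ∈ S, ∀ s' ∈ S, ¬ E s s' := by
    intro s hs s' hs' hss
    obtain ⟨v, hv, -⟩ := h𝒰.exists_other S hS s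
    obtain ⟨y, hy⟩ := h.exists_out v
    refine hv (h.reach (fun a b => a ∈ S ∧ b ∈ S) ⟨fun a b b' h₁ h₂ h₃ => ⟨h₃.1, ?_⟩,
      fun a a' b h₁ h₂ h₃ => ⟨?_, h₃.2⟩⟩ s s' v y hss hy ⟨hs, hs'⟩).1
    · exact h.out_mem_of_edge h𝒰 hS h₃.1 h₃.2 h₁ h₂
    · exact h.dual.out_mem_of_edge (dual_sys h𝒰) hS h₃.2 h₃.1 h₁ h₂
  rw [h.adj_iff]
  exact fun h => h.elim (key s hs s' hs') (key s' hs' s hs)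

theorem nbr_notMem (h : HomDigraph E) (h𝒰 : SepSystem (UG E) 𝒰) {S : Set V} (hS : S ∈ 𝒰)
    {s x : V} (hs : s ∈ S) (hx : (UG E).Adj s x) : x ∉ S := fun hxS => h.indep h𝒰 hS hs hxS hx

theorem not_sameDir (h : HomDigraph E) (h𝒰 : SepSystem (UG E) 𝒰) {S : Set V} (hS : S ∈ 𝒰)
    {s a x b y : V} (hs : s ∈ S) (hsx : (UG E).Adj s x) (hsy : (UG E).Adj s y)
    (hax : ConnOff (UG E) S a x) (hne : a ≠ x) (hab : ¬ ConnOff (UG E) S a b)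
    (hay : ¬ ConnOff (UG E) S a y) (hby : b ≠ y) : ¬ SameDir E s a b := by
  intro hdir
  have hsb : (UG E).Adj s b := h.adj_iff.2 (hdir.imp And.right And.right)
  have hbS := h.nbr_notMem h𝒰 hS hs hsb
  have hyS := h.nbr_notMem h𝒰 hS hs hsy
  obtain ⟨ψ, hψ, -, h₂, h₃, h₄⟩ := h.exists_swap hdir (X := {x, y}) (Set.toFinite _)
    (by rintro z (rfl | rfl) <;> assumption)
    (by
      rintro (e | e)
      · exact hne e
      · exact hay (e ▸ .refl hax.1))
    (by
      rintro (e | e)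
      · exact hab (e ▸ hax)
      · exact hby e)
  have hx : ψ x = x := h₄ x (.inl rfl)
  have hy : ψ y = y := h₄ y (.inr rfl)
  have c₁ : ConnOff (UG E) (ψ '' S) b x := by rwa [← h₂, ← hx, hψ.connOff_iff]
  have c₂ : ¬ ConnOff (UG E) (ψ '' S) b a := by
    have : ¬ ConnOff (UG E) (ψ '' S) (ψ a) (ψ b) := by rwa [hψ.connOff_iff]
    rwa [h₂, h₃] at this
  have c₃ : ¬ ConnOff (UG E) (ψ '' S) b y := by rwa [← h₂, ← hy, hψ.connOff_iff]
  have hST : S ≠ ψ '' S := fun e => by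
    rw [← e] at c₁
    exact hab (hax.trans c₁.symm)
  obtain ⟨m, -, n, -, -, -, -, -, hmn, -⟩ :=
    h𝒰.exists_pair hS (h𝒰.image S hS ψ hψ.isAut) hST
  by_cases hma : ConnOff (UG E) S m a
  · have e₁ := hmn b hbS fun h' => hab (hma.symm.trans h')
    have e₂ := hmn y hyS fun h' => hay (hma.symm.trans h')
    exact c₃ (e₁.symm.trans e₂)
  · have e₁ := hmn a hax.1 hma
    have e₂ := hmn x hax.right_notMem fun h' => hma (h'.trans hax.symm)
    exact c₂ (c₁.trans (e₂.symm.trans e₁))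

/-- `b` is the only neighbour of `s ∈ S` in its component of `G` minus `S`. -/
def Pendant (G : SimpleGraph V) (S : Set V) (s b : V) : Prop :=
  s ∈ S ∧ ∀ b', G.Adj s b' → ConnOff G S b b' → b' = b

theorem exists_pendant (h : HomDigraph E) (h𝒰 : SepSystem (UG E) 𝒰) :
    ∃ S ∈ 𝒰, ∃ s b, (UG E).Adj s b ∧ Pendant (UG E) S s b := by
  by_contra! hcon
  have key : ∀ S ∈ 𝒰, ∀ s ∈ S, ∀ a b, SameDir E s a b → ConnOff (UG E) S a b := by
    intro S hS s hs a b hdir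
    by_contra hab
    have hP : ∀ b, (UG E).Adj s b → ∃ b', (UG E).Adj s b' ∧ ConnOff (UG E) S b b' ∧ b' ≠ b := by
      intro b hb
      by_contra! hP
      exact hcon S hS s b hb ⟨hs, hP⟩
    obtain ⟨x, hsx, hax, hxa⟩ := hP a (h.adj_iff.2 (hdir.imp And.left And.left))
    obtain ⟨y, hsy, hby, hyb⟩ := hP b (h.adj_iff.2 (hdir.imp And.right And.right))
    exact h.not_sameDir h𝒰 hS hs hsx hsy hax hxa.symm hab
      (fun h' => hab (h'.trans hby.symm)) hyb.symm hdir
  obtain ⟨S, hS⟩ := h𝒰.nonempty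
  obtain ⟨s, hs⟩ := h𝒰.nonempty_of_mem S hS
  obtain ⟨k, hsk, hkS, -⟩ := h𝒰.exists_nbr hS hs s
  obtain ⟨l, hsl, -, hkl⟩ := h𝒰.exists_nbr hS hs k
  have hinv : AltInvariant E fun a b => ConnOff (UG E) S k a ∨ ConnOff (UG E) S k b := by
    constructor
    · intro a b b' hab hab' hF
      by_cases ha : a ∈ S
      · have hF := hF.resolve_left fun h' => h'.right_notMem ha
        exact .inr (hF.trans (key S hS a ha b b' (.inl ⟨hab, hab'⟩)))
      · refine .inl (hF.elim id fun hF => hF.step (h.adj_iff.2 (.inr hab)) ha)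
    · intro a a' b hab hab' hF
      by_cases hb : b ∈ S
      · have hF := hF.resolve_right fun h' => h'.right_notMem hb
        exact .inl (hF.trans (key S hS b hb a a' (.inr ⟨hab, hab'⟩)))
      · refine .inr (hF.elim (fun hF => hF.step (h.adj_iff.2 (.inl hab)) hb) id)
  have hall : ∀ x y, E x y → ConnOff (UG E) S k x ∨ ConnOff (UG E) S k y := by
    intro x y hxy
    rcases h.adj_iff.1 hsk with h' | h'
    · exact h.reach _ hinv s k x y h' hxy (.inr (.refl hkS))
    · exact h.reach _ hinv k s x y h' hxy (.inl (.refl hkS))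
  rcases h.adj_iff.1 hsl with h' | h'
  · exact (hall s l h').elim (fun h' => h'.right_notMem hs) hkl
  · exact (hall l s h').elim hkl fun h' => h'.right_notMem hs

theorem not_mem_of_pendant (h : HomDigraph E) (h𝒰 : SepSystem (UG E) 𝒰) {S : Set V} (hS : S ∈ 𝒰)
    {s b c : V} (hP : Pendant (UG E) S s b) (hsb : E s b) (hcb : E c b) (hcs : c ≠ s) :
    c ∉ S := by
  intro hc
  obtain ⟨hs, hPb⟩ := hP
  have hbS := h.nbr_notMem h𝒰 hS hs (h.adj_iff.2 (.inl hsb))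
  obtain ⟨ψ, hψ, hb, h₂, h₃, -⟩ := h.exists_swap (s := b) (.inr ⟨hsb, hcb⟩) Set.finite_empty
    (by simp) (by simp) (by simp)
  have hT := h𝒰.image S hS ψ hψ.isAut
  have hbT : b ∉ ψ '' S := by
    rw [← hb, ψ.injective.mem_set_image]
    exact hbS
  have hPc : ∀ z, (UG E).Adj c z → ConnOff (UG E) (ψ '' S) b z → z = b := by
    intro z hcz hbz
    obtain ⟨z, rfl⟩ := ψ.surjective z
    rw [← h₂, hψ.adj_iff] at hcz
    rw [← hb, hψ.connOff_iff] at hbz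
    rw [hPb z hcz hbz, hb]
  have hQc : ∀ z, (UG E).Adj c z → ConnOff (UG E) S b z → z = b := by
    intro z hcz hbz
    by_contra hzb
    have hST : S ≠ ψ '' S := fun e => hzb (hPc z hcz (e ▸ hbz))
    obtain ⟨m, -, n, -, -, -, -, -, hmn, hnm⟩ := h𝒰.exists_pair hS hT hST
    have hm : ConnOff (UG E) S m b := by
      by_contra hm
      have e₁ := hmn b hbS hm
      have e₂ := hmn z hbz.right_notMem fun h' => hm (h'.trans hbz.symm)
      exact hzb (hPc z hcz (e₁.symm.trans e₂))
    have hbz' : ConnOff (UG E) (ψ '' S) b (ψ z) := by rwa [← hb, hψ.connOff_iff]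
    have hn : ConnOff (UG E) (ψ '' S) n b := by
      by_contra hn
      have e₁ := hnm b hbT hn
      have e₂ := hnm (ψ z) hbz'.right_notMem fun h' => hn (h'.trans hbz'.symm)
      have hsz : (UG E).Adj s (ψ z) := by rwa [← h₃, hψ.adj_iff]
      exact hzb (ψ.injective ((hPb _ hsz (e₁.symm.trans e₂)).trans hb.symm))
    obtain ⟨w, hcw, hwS, hbw⟩ := h𝒰.exists_nbr hS hc b
    have hsw : (UG E).Adj s (ψ w) := by rwa [← h₃, hψ.adj_iff]
    have hwb : ψ w ≠ b := fun e => hbw (by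
      rw [ψ.injective (e.trans hb.symm)]
      exact .refl hbS)
    have e₁ := hmn (ψ w) (h.nbr_notMem h𝒰 hS hs hsw) fun h' =>
      hwb (hPb _ hsw (hm.symm.trans h'))
    have e₂ := hn.symm.trans e₁
    rw [← hb, hψ.connOff_iff] at e₂
    exact hbw e₂
  have hsub : Nbhd (UG E) (compOff (UG E) S b \ {b}) ⊆ insert b (S \ {s, c}) := by
    rintro v ⟨hv, w, ⟨hw, hwb⟩, hwv⟩
    by_cases hvb : v = b
    · exact .inl hvb
    have hvS : v ∈ S := by
      by_contra hvS
      exact hv ⟨ConnOff.step hw hwv hvS, hvb⟩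
    refine .inr ⟨hvS, ?_⟩
    rintro (rfl | rfl)
    · exact hwb (hPb w hwv.symm hw)
    · exact hwb (hQc w hwv.symm hw)
  have hfin := h𝒰.finite S hS
  have e₁ := h𝒰.ncard_le S hS b hbS b
  have e₂ := Set.ncard_le_ncard hsub (hfin.sdiff.insert b)
  have e₃ := Set.ncard_insert_le b (S \ {s, c})
  have e₄ := Set.ncard_sdiff_add_ncard_of_subset (s := {s, c}) (t := S)
    (by rintro z (rfl | rfl) <;> assumption) hfin
  rw [Set.ncard_pair hcs.symm] at e₄
  omega

theorem unique_nbr_of_pendant (h : HomDigraph E) (h𝒰 : SepSystem (UG E) 𝒰) {S : Set V}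
    (hS : S ∈ 𝒰) {s b c o o' : V} (hP : Pendant (UG E) S s b) (hsb : E s b) (hbc : E b c)
    (hc : c ∈ S) (hco : (UG E).Adj c o) (ho : ¬ ConnOff (UG E) S b o)
    (hco' : (UG E).Adj c o') (ho' : ¬ ConnOff (UG E) S b o') : o = o' := by
  by_contra hoo
  have hbS := h.nbr_notMem h𝒰 hS hP.1 (h.adj_iff.2 (.inl hsb))
  obtain ⟨s', hs's, hs'b⟩ := h.exists_in_ne b s
  have hs'S := h.not_mem_of_pendant h𝒰 hS hP hsb hs'b hs's
  obtain ⟨hs, hPb⟩ := hP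
  obtain ⟨ψ, hψ, hb, h₂, h₃, h₄⟩ := h.exists_swap (s := b) (.inr ⟨hsb, hs'b⟩) (X := {c})
    (Set.finite_singleton c) (by rintro z rfl; exact h.adj_iff.2 (.inl hbc))
    (by rintro rfl; exact h.isDigraph.2 _ _ hsb hbc) (by rintro rfl; exact hs'S hc)
  have hψc : ψ c = c := h₄ c rfl
  have hT := h𝒰.image S hS ψ hψ.isAut
  have hbT : b ∉ ψ '' S := by
    rw [← hb, ψ.injective.mem_set_image]
    exact hbS
  have hsT : s ∉ ψ '' S := by
    rw [← h₃, ψ.injective.mem_set_image]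
    exact hs'S
  have hs'T : s' ∈ ψ '' S := ⟨s, hs, h₂⟩
  have hST : S ≠ ψ '' S := fun e => hsT (e ▸ hs)
  obtain ⟨m, -, n, -, -, -, hm, hn, hmn, hnm⟩ := h𝒰.exists_pair hS hT hST
  have hmb := (hm s' hs'T hs'S).step (h.adj_iff.2 (.inl hs'b)) hbS
  have hnb := (hn s hs hsT).step (h.adj_iff.2 (.inl hsb)) hbT
  have hcψ : (UG E).Adj c (ψ o) := by rwa [← hψc, hψ.adj_iff]
  have hψS := h.nbr_notMem h𝒰 hS hc hcψ
  have hψT : ψ o ∉ ψ '' S := by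
    rw [ψ.injective.mem_set_image]
    exact h.nbr_notMem h𝒰 hS hc hco
  have hψb : ψ o ≠ b := fun e => ho (by
    rw [ψ.injective (e.trans hb.symm)]
    exact .refl hbS)
  have hbψ : ¬ ConnOff (UG E) (ψ '' S) b (ψ o) := by rwa [← hb, hψ.connOff_iff]
  have hbψS : ConnOff (UG E) S b (ψ o) := by
    by_contra h'
    exact hbψ (hnb.symm.trans (hmn _ hψS fun h'' => h' (hmb.symm.trans h'')))
  have hcb : (UG E).Adj c b := h.adj_iff.2 (.inr hbc)
  have hdir : E c o := by
    refine (h.adj_iff.1 hco).resolve_right fun hoc => ?_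
    exact h.not_sameDir h𝒰 hS hc hcψ hco' hbψS hψb.symm ho ho' hoo (.inr ⟨hbc, hoc⟩)
  have hdir' : E c (ψ o) := by rwa [← hψc, hψ]
  exact h.not_sameDir h𝒰 hS hc hcb hco' hbψS.symm hψb (fun h' => ho (hbψS.trans h'))
    (fun h' => ho' (hbψS.trans h')) hoo (.inl ⟨hdir', hdir⟩)

/-- Every neighbour of `b` other than `s` lies in the component of `b`, or it lies in `S` and has at
most one neighbour outside that component; and `b` is the only neighbour of `s` there. -/
def Leaf (G : SimpleGraph V) (S : Set V) (s b : V) : Prop :=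
  Pendant G S s b ∧ b ∉ S ∧ ∀ c, G.Adj b c → c ≠ s → ConnOff G S b c ∨
    (c ∈ S ∧ ∃ o, ∀ z, G.Adj c z → ¬ ConnOff G S b z → z = o)

theorem leaf_of_pendant (h : HomDigraph E) (h𝒰 : SepSystem (UG E) 𝒰) {S : Set V} (hS : S ∈ 𝒰)
    {s b : V} (hP : Pendant (UG E) S s b) (hsb : E s b) : Leaf (UG E) S s b := by
  have hbS := h.nbr_notMem h𝒰 hS hP.1 (h.adj_iff.2 (.inl hsb))
  refine ⟨hP, hbS, fun c hbc hcs => ?_⟩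
  by_cases hc : c ∈ S
  · refine .inr ⟨hc, ?_⟩
    have hbc' := (h.adj_iff.1 hbc).resolve_right fun hcb =>
      h.not_mem_of_pendant h𝒰 hS hP hsb hcb hcs hc
    obtain ⟨o, hco, -, ho⟩ := h𝒰.exists_nbr hS hc b
    exact ⟨o, fun z hcz hz => h.unique_nbr_of_pendant h𝒰 hS hP hsb hbc' hc hcz hz hco ho⟩
  · exact .inl (.of_adj hbc hbS hc)

theorem Pendant.image {ψ : Equiv.Perm V} (hψ : IsDiAut E ψ) {S : Set V} {s b : V}
    (hP : Pendant (UG E) S s b) : Pendant (UG E) (ψ '' S) (ψ s) (ψ b) := by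
  refine ⟨Set.mem_image_of_mem _ hP.1, fun z hz hbz => ?_⟩
  obtain ⟨z, rfl⟩ := ψ.surjective z
  rw [hψ.adj_iff] at hz
  rw [hψ.connOff_iff] at hbz
  rw [hP.2 z hz hbz]

theorem exists_leaf_of_edge (h : HomDigraph E) (h𝒰 : SepSystem (UG E) 𝒰) {S : Set V} (hS : S ∈ 𝒰)
    {s b : V} (hP : Pendant (UG E) S s b) (hsb : E s b) {x y : V} (hxy : (UG E).Adj x y) :
    ∃ S ∈ 𝒰, Leaf (UG E) S x y ∨ Leaf (UG E) S y x := by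
  have key : ∀ x y, E x y → ∃ S ∈ 𝒰, Leaf (UG E) S x y := by
    intro x y hxy
    obtain ⟨ψ, hψ, rfl, rfl⟩ := h.edge_trans hsb hxy
    have hT := h𝒰.image S hS ψ hψ.isAut
    exact ⟨_, hT, h.leaf_of_pendant h𝒰 hT (hP.image hψ) hxy⟩
  rcases h.adj_iff.1 hxy with hxy | hxy
  · obtain ⟨T, hT, hl⟩ := key x y hxy
    exact ⟨T, hT, .inl hl⟩
  · obtain ⟨T, hT, hl⟩ := key y x hxy
    exact ⟨T, hT, .inr hl⟩

theorem exists_leaf (h : HomDigraph E) (h𝒰 : SepSystem (UG E) 𝒰) {x y : V}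
    (hxy : (UG E).Adj x y) : ∃ S ∈ 𝒰, Leaf (UG E) S x y ∨ Leaf (UG E) S y x := by
  obtain ⟨S, hS, s, b, hsb, hP⟩ := h.exists_pendant h𝒰
  rcases h.adj_iff.1 hsb with hsb | hsb
  · exact h.exists_leaf_of_edge h𝒰 hS hP hsb hxy
  · rw [← ug_flip] at hP hxy ⊢
    exact h.dual.exists_leaf_of_edge (dual_sys h𝒰) hS hP hsb hxy

end HomDigraph

end LocalStructure

section Acyclic

variable {V : Type u} {G : SimpleGraph V} {𝒰 : Set (Set V)}

/-- `A` together with its neighbours having at most one neighbour outside `A`. -/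
def thicken (G : SimpleGraph V) (A : Set V) : Set V :=
  {v | v ∈ A ∨ ((∃ a ∈ A, G.Adj v a) ∧ ∃ o, ∀ z, G.Adj v z → z ∉ A → z = o)}

theorem thicken_mono {A B : Set V} (hAB : A ⊆ B) : thicken G A ⊆ thicken G B := by
  rintro v (hv | ⟨⟨a, ha, hva⟩, o, ho⟩)
  · exact .inl (hAB hv)
  · exact .inr ⟨⟨a, hAB ha, hva⟩, o, fun z hz hzB => ho z hz fun hzA => hzB (hAB hzA)⟩

theorem Sides.thicken_disjoint {S A B : Set V} (h : Sides G S A B)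
    (hdeg : ∀ v o o', ∃ z, G.Adj v z ∧ z ≠ o ∧ z ≠ o') {v : V} (hA : v ∈ thicken G A) :
    v ∉ thicken G B := by
  rintro (hB | ⟨⟨b, hb, hvb⟩, o', ho'⟩) <;> rcases hA with hA | ⟨⟨a, ha, hva⟩, o, ho⟩
  · exact h.disj v hA hB
  · exact h.noAdj a ha v hB hva.symm
  · exact h.noAdj v hA b hb hvb
  · obtain ⟨z, hvz, hzo, hzo'⟩ := hdeg v o o'
    by_cases hzA : z ∈ A
    · exact hzo' (ho' z hvz (h.disj z hzA))
    · exact hzo (ho z hvz hzA)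

/-- One of `A`, `B` is a component of `G` minus `S`, the other is the union of the other
components. -/
def IsWingPair (G : SimpleGraph V) (S A B : Set V) : Prop :=
  ∃ u, u ∉ S ∧ ((A = compOff G S u ∧ B = (compOff G S u ∪ S)ᶜ) ∨
    (B = compOff G S u ∧ A = (compOff G S u ∪ S)ᶜ))

theorem sides_compOff (S : Set V) (u : V) :
    Sides G S (compOff G S u) (compOff G S u ∪ S)ᶜ := by
  refine ⟨fun v hv => ?_, fun v hv => ConnOff.right_notMem hv, fun v hv h => hv (.inr h),
    fun v hv h => h (.inl hv), fun a ha b hb hab => hb (.inl (ConnOff.step ha hab ?_))⟩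
  · by_cases h : v ∈ compOff G S u
    · exact .inl h
    · exact .inr fun h' => h'.elim h hv
  · exact fun h => hb (.inr h)

theorem IsWingPair.sides {S A B : Set V} (h : IsWingPair G S A B) : Sides G S A B := by
  obtain ⟨u, -, ⟨rfl, rfl⟩ | ⟨rfl, rfl⟩⟩ := h
  · exact sides_compOff S u
  · exact (sides_compOff S u).symm

/-- The four ways in which two pairs of wings may be nested. -/
def NestedWings (A₀ B₀ A₁ B₁ : Set V) : Prop :=
  (A₀ ⊆ A₁ ∧ B₁ ⊆ B₀) ∨ (A₀ ⊆ B₁ ∧ A₁ ⊆ B₀) ∨ (B₀ ⊆ A₁ ∧ B₁ ⊆ A₀) ∨ (B₀ ⊆ B₁ ∧ A₁ ⊆ A₀)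

theorem SepSystem.nestedWings_compOff (h𝒰 : SepSystem G 𝒰) {S T : Set V} (hS : S ∈ 𝒰)
    (hT : T ∈ 𝒰) (u v : V) :
    NestedWings (compOff G S u) (compOff G S u ∪ S)ᶜ (compOff G T v) (compOff G T v ∪ T)ᶜ := by
  by_cases hST : S = T
  · subst hST
    by_cases huv : ConnOff G S u v
    · have : compOff G S u = compOff G S v :=
        Set.ext fun x => ⟨fun h => huv.symm.trans h, fun h => huv.trans h⟩
      rw [this]
      exact .inl ⟨subset_rfl, subset_rfl⟩
    · refine .inr (.inl ⟨fun x hx => ?_, fun x hx => ?_⟩)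
      · exact fun h => h.elim (fun h => huv (ConnOff.trans hx (ConnOff.symm h)))
          (ConnOff.right_notMem hx)
      · exact fun h => h.elim (fun h => huv (ConnOff.trans h (ConnOff.symm hx)))
          (ConnOff.right_notMem hx)
  obtain ⟨m, -, n, -, -, -, -, -, hmn, hnm⟩ := h𝒰.exists_pair hS hT hST
  by_cases hm : ConnOff G S m u <;> by_cases hn : ConnOff G T n v
  · refine .inr (.inr (.inl ⟨fun x hx => ?_, fun x hx => ?_⟩))
    · exact hn.symm.trans
        (hmn x (fun h => hx (.inr h)) fun h => hx (.inl (hm.symm.trans h)))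
    · exact hm.symm.trans
        (hnm x (fun h => hx (.inr h)) fun h => hx (.inl (hn.symm.trans h)))
  · refine .inr (.inr (.inr ⟨fun x hx => ?_, fun x hx => ?_⟩))
    · have h := hmn x (fun h => hx (.inr h)) fun h => hx (.inl (hm.symm.trans h))
      exact fun h' => h'.elim (fun h' => hn (h.trans (ConnOff.symm h'))) h.right_notMem
    · exact hm.symm.trans
        (hnm x (ConnOff.right_notMem hx) fun h => hn (h.trans (ConnOff.symm hx)))
  · refine .inl ⟨fun x hx => ?_, fun x hx => ?_⟩
    · exact hn.symm.trans
        (hmn x (ConnOff.right_notMem hx) fun h => hm (h.trans (ConnOff.symm hx)))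
    · have h := hnm x (fun h => hx (.inr h)) fun h => hx (.inl (hn.symm.trans h))
      exact fun h' => h'.elim (fun h' => hm (h.trans (ConnOff.symm h'))) h.right_notMem
  · refine .inr (.inl ⟨fun x hx => ?_, fun x hx => ?_⟩)
    · have h := hmn x (ConnOff.right_notMem hx) fun h => hm (h.trans (ConnOff.symm hx))
      exact fun h' => h'.elim (fun h' => hn (h.trans (ConnOff.symm h'))) h.right_notMem
    · have h := hnm x (ConnOff.right_notMem hx) fun h => hn (h.trans (ConnOff.symm hx))
      exact fun h' => h'.elim (fun h' => hm (h.trans (ConnOff.symm h'))) h.right_notMem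

theorem SepSystem.nestedWings (h𝒰 : SepSystem G 𝒰) {S T : Set V} (hS : S ∈ 𝒰) (hT : T ∈ 𝒰)
    {A₀ B₀ A₁ B₁ : Set V} (h₀ : IsWingPair G S A₀ B₀) (h₁ : IsWingPair G T A₁ B₁) :
    NestedWings A₀ B₀ A₁ B₁ := by
  obtain ⟨u, -, h₀⟩ := h₀
  obtain ⟨v, -, h₁⟩ := h₁
  have key := h𝒰.nestedWings_compOff hS hT u v
  unfold NestedWings at key ⊢
  rcases h₀ with ⟨rfl, rfl⟩ | ⟨rfl, rfl⟩ <;> rcases h₁ with ⟨rfl, rfl⟩ | ⟨rfl, rfl⟩ <;> tauto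

/-- The wings `A` and `B` separate the edge `v₀ v₁`: `v₀` and its other neighbours are close to
`A`, and `v₁` and its other neighbours are close to `B`. -/
structure SplitsEdge (G : SimpleGraph V) (A B : Set V) (v₀ v₁ : V) : Prop where
  left : v₀ ∈ thicken G A
  left_nbr : ∀ z, G.Adj v₀ z → z ≠ v₁ → z ∈ thicken G A
  right : v₁ ∈ thicken G B
  right_nbr : ∀ z, G.Adj v₁ z → z ≠ v₀ → z ∈ thicken G B

theorem SplitsEdge.symm {A B : Set V} {v₀ v₁ : V} (h : SplitsEdge G A B v₀ v₁) :
    SplitsEdge G B A v₁ v₀ := ⟨h.right, h.right_nbr, h.left, h.left_nbr⟩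

theorem SepSystem.thicken_subset (h𝒰 : SepSystem G 𝒰)
    (hdeg : ∀ v o o', ∃ z, G.Adj v z ∧ z ≠ o ∧ z ≠ o') {S T : Set V} (hS : S ∈ 𝒰) (hT : T ∈ 𝒰)
    {A₀ B₀ A₁ B₁ : Set V} (h₀ : IsWingPair G S A₀ B₀) (h₁ : IsWingPair G T A₁ B₁) {v₀ v₁ v₂ : V}
    (e₀ : SplitsEdge G A₀ B₀ v₀ v₁) (e₁ : SplitsEdge G A₁ B₁ v₁ v₂) (h₀₁ : G.Adj v₀ v₁)
    (h₁₂ : G.Adj v₁ v₂) (hne : v₀ ≠ v₂) : thicken G B₁ ⊆ thicken G B₀ := by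
  rcases h𝒰.nestedWings hS hT h₀ h₁ with h | h | h | h
  · exact thicken_mono h.2
  · exact absurd (thicken_mono h.1 e₀.left)
      (h₁.sides.thicken_disjoint hdeg (e₁.left_nbr v₀ h₀₁.symm hne))
  · exact absurd e₁.right (h₁.sides.thicken_disjoint hdeg
      (thicken_mono h.1 (e₀.right_nbr v₂ h₁₂ hne.symm)))
  · exact absurd (thicken_mono h.1 e₀.right) (h₁.sides.thicken_disjoint hdeg e₁.left)

theorem SepSystem.no_closed_walk (h𝒰 : SepSystem G 𝒰)
    (hdeg : ∀ v o o', ∃ z, G.Adj v z ∧ z ≠ o ∧ z ≠ o')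
    (hsplit : ∀ x y, G.Adj x y → ∃ S ∈ 𝒰, ∃ A B, IsWingPair G S A B ∧ SplitsEdge G A B x y)
    (f : ℕ → V) (n : ℕ) (hadj : ∀ i ≤ n, G.Adj (f i) (f (i + 1)))
    (hne : ∀ i < n, f i ≠ f (i + 2)) : f (n + 1) ≠ f 0 := by
  intro hclosed
  obtain ⟨S, hS, A, B, hw, he⟩ := hsplit _ _ (hadj 0 (by omega))
  have key : ∀ i, i ≤ n → ∃ T ∈ 𝒰, ∃ C D, IsWingPair G T C D ∧ SplitsEdge G C D (f i) (f (i + 1)) ∧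
      thicken G D ⊆ thicken G B := by
    intro i
    induction i with
    | zero => exact fun _ => ⟨S, hS, A, B, hw, he, subset_rfl⟩
    | succ i ih =>
      intro hi
      obtain ⟨T, hT, C, D, hw', he', hsub⟩ := ih (by omega)
      obtain ⟨T₁, hT₁, C₁, D₁, hw₁, he₁⟩ := hsplit _ _ (hadj (i + 1) hi)
      exact ⟨T₁, hT₁, C₁, D₁, hw₁, he₁, (h𝒰.thicken_subset hdeg hT hT₁ hw' hw₁ he' he₁
        (hadj i (by omega)) (hadj (i + 1) hi) (hne i (by omega))).trans hsub⟩
  obtain ⟨T, hT, C, D, -, he', hsub⟩ := key n le_rfl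
  exact hw.sides.thicken_disjoint hdeg he.left (hclosed ▸ hsub he'.right)

end Acyclic

section Conclusion

variable {V : Type u} {E : V → V → Prop} {𝒰 : Set (Set V)}

namespace HomDigraph

theorem exists_nbr_ne (h : HomDigraph E) (v o o' : V) : ∃ z, (UG E).Adj v z ∧ z ≠ o ∧ z ≠ o' := by
  obtain ⟨a, hao, hva⟩ := h.exists_out_ne v o
  by_cases hao' : a = o'
  · obtain ⟨b, hbo, hbv⟩ := h.exists_in_ne v o
    refine ⟨b, h.adj_iff.2 (.inr hbv), hbo, ?_⟩
    rintro rfl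
    exact h.isDigraph.2 _ _ hva (hao' ▸ hbv)
  · exact ⟨a, h.adj_iff.2 (.inl hva), hao, hao'⟩

theorem splitsEdge_of_leaf (h : HomDigraph E) (h𝒰 : SepSystem (UG E) 𝒰) {S : Set V} (hS : S ∈ 𝒰)
    {s b : V} (hl : Leaf (UG E) S s b) :
    SplitsEdge (UG E) (compOff (UG E) S b ∪ S)ᶜ (compOff (UG E) S b) s b := by
  obtain ⟨⟨hs, hPb⟩, hbS, hc⟩ := hl
  have key : ∀ z, (UG E).Adj s z → z ≠ b → z ∈ (compOff (UG E) S b ∪ S)ᶜ := fun z hz hzb h' =>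
    h'.elim (fun h' => hzb (hPb z hz h')) (h.nbr_notMem h𝒰 hS hs hz)
  refine ⟨.inr ⟨?_, b, fun z hz hzA => ?_⟩, fun z hz hzb => .inl (key z hz hzb),
    .inl (.refl hbS), fun z hz hzs => ?_⟩
  · obtain ⟨z, hz, hzS, hbz⟩ := h𝒰.exists_nbr hS hs b
    exact ⟨z, fun h' => h'.elim hbz hzS, hz⟩
  · by_contra hzb
    exact hzA (key z hz hzb)
  · rcases hc z hz hzs with h' | ⟨-, ho⟩
    · exact .inl h'
    · exact .inr ⟨⟨b, .refl hbS, hz.symm⟩, ho⟩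

theorem exists_splitsEdge (h : HomDigraph E) (h𝒰 : SepSystem (UG E) 𝒰) {x y : V}
    (hxy : (UG E).Adj x y) :
    ∃ S ∈ 𝒰, ∃ A B, IsWingPair (UG E) S A B ∧ SplitsEdge (UG E) A B x y := by
  obtain ⟨S, hS, hl | hl⟩ := h.exists_leaf h𝒰 hxy
  · exact ⟨S, hS, _, _, ⟨y, hl.2.1, .inr ⟨rfl, rfl⟩⟩, h.splitsEdge_of_leaf h𝒰 hS hl⟩
  · exact ⟨S, hS, _, _, ⟨x, hl.2.1, .inl ⟨rfl, rfl⟩⟩, (h.splitsEdge_of_leaf h𝒰 hS hl).symm⟩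

end HomDigraph

end Conclusion

/-- In a connected C-homogeneous triangle-free digraph with more than one end,
every reachability digraph is bipartite: its underlying undirected graph contains
no cycle of odd length. -/
theorem stmt_9 {V : Type u} (E : V → V → Prop) (hD : IsDigraph E)
    (hconn : (UG E).Connected) (hhom : DigraphCHom E) (htf : ¬ HasTriangle E)
    (hends : MoreThanOneEnd (UG E)) (e : V × V) (he : E e.1 e.2) :
    ∀ (v : V) (w : (DeltaGraph E e).Walk v v), w.IsCycle → ¬ Odd w.length := by
  intro v w hw hodd
  obtain ⟨x, y, z, hxy, hyz⟩ := exists_two_arc ⟨v, w, hodd⟩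
  have h := homDigraph_of_two_arc hD hconn hhom htf he hxy hyz
  obtain ⟨𝒰, h𝒰⟩ := exists_sepSystem hconn hends fun x y => by
    obtain ⟨ψ, hψ, hx⟩ := h.vertex_trans x y
    exact ⟨ψ, hψ.isAut, hx⟩
  have hlen := hw.three_le_length
  refine h𝒰.no_closed_walk h.exists_nbr_ne (fun x y => h.exists_splitsEdge h𝒰) w.getVert
    (w.length - 1) (fun i hi => ?_) (fun i hi heq => ?_) ?_
  · have hadj := w.adj_getVert_succ (i := i) (by omega)
    simp only [DeltaGraph, UG, SimpleGraph.fromRel_adj] at hadj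
    exact h.adj_iff.2 (hadj.2.imp And.left And.left)
  · by_cases hi₀ : i = 0
    · have := hw.getVert_injOn' (x₁ := i) (x₂ := i + 2) (by simp; omega) (by simp; omega) heq
      omega
    · have := hw.getVert_injOn (x₁ := i) (x₂ := i + 2) (by simp; omega) (by simp; omega) heq
      omega
  · rw [Nat.sub_add_cancel (by omega), w.getVert_length, w.getVert_zero]
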